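/- arXiv:1612.07073 — 8 statements merged into one kernel-verified Lean document; each statement's English description precedes it below -/
import Mathlib

section
/- For any two continua K⁻ and K⁺ in the Riemann sphere, there exists a two-sided sequence p : ℤ → ℂ such that: (i) the cluster set of p along n → −∞ equals K⁻ and the cluster set of p along n → +∞ equals K⁺; (ii) for every n ∈ ℤ the three consecutive points p(n), p(n+1), p(n+2) are not collinear; (iii) there are strictly increasing sequences of indices n(k) → +∞ and n(ℓ) → +∞ such that for every k the difference p(n(k)+1) − p(n(k)) is a positive real number (horizontal segment with p(n(k)) as left endpoint), for every ℓ the difference p(n(ℓ)+1) − p(n(ℓ)) is a positive multiple of i (vertical segment with p(n(ℓ)) as lower endpoint), and the cluster sets (in OnePoint ℂ) of both subsequences k ↦ p(n(k)) and ℓ ↦ p(n(ℓ)) equal K⁺; (iv) analogously there are strictly decreasing sequences of indices tending to −∞ with horizontal, respectively vertical, segments whose corresponding subsequences both have cluster set exactly K⁻. -/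
open Filter Topology

/-- If `f` and `g` get arbitrarily close along `l`, they have the same cluster points. -/
theorem mapClusterPt_congr_of_tendsto_dist {α X : Type*} [PseudoMetricSpace X] {l : Filter α}
    {f g : α → X} (h : Tendsto (fun a => dist (f a) (g a)) l (𝓝 0)) {w : X} :
    MapClusterPt w l f ↔ MapClusterPt w l g := by
  suffices H : ∀ {f g : α → X}, Tendsto (fun a => dist (f a) (g a)) l (𝓝 0) →
      MapClusterPt w l f → MapClusterPt w l g from
    ⟨H h, H (by simpa only [dist_comm] using h)⟩
  intro f g h hf
  rw [Metric.nhds_basis_ball.mapClusterPt_iff_frequently] at hf ⊢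
  intro ε hε
  have h2 : ∀ᶠ a in l, dist (f a) (g a) < ε / 2 := h.eventually (gt_mem_nhds (half_pos hε))
  refine ((hf (ε / 2) (half_pos hε)).and_eventually h2).mono fun a ha => ?_
  have h3 := dist_triangle_left (g a) w (f a)
  have h4 := ha.1
  rw [Metric.mem_ball] at h4 ⊢
  linarith [ha.2]

/-- Every nonempty closed subset of a separable metric space is the cluster set of a sequence
taking values in a prescribed dense range. -/
theorem exists_seq_clusterSet_eq {X Y : Type*} [MetricSpace X] [SecondCountableTopology X]
    {i : Y → X} (hi : DenseRange i) {K : Set X} (hK : IsClosed K) (hne : K.Nonempty) :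
    ∃ c : ℕ → Y, {w : X | MapClusterPt w atTop fun n => i (c n)} = K := by
  have : Nonempty K := hne.to_subtype
  let a : ℕ → K := TopologicalSpace.denseSeq K
  have ha : DenseRange a := TopologicalSpace.denseRange_denseSeq K
  choose c hc using fun n : ℕ =>
    hi.exists_dist_lt (a n.unpair.1 : X) (Nat.one_div_pos_of_nat (α := ℝ) (n := n))
  refine ⟨c, ?_⟩
  have hdist : Tendsto (fun n => dist (i (c n)) (a n.unpair.1 : X)) atTop (𝓝 0) :=
    squeeze_zero (fun _ => dist_nonneg) (fun n => by rw [dist_comm]; exact (hc n).le)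
      tendsto_one_div_add_atTop_nhds_zero_nat
  ext w
  simp only [Set.mem_ofPred_eq]
  rw [mapClusterPt_congr_of_tendsto_dist hdist]
  constructor
  · intro hw
    exact isClosed_iff_clusterPt.mp hK w <| hw.clusterPt.mono <|
      tendsto_principal.mpr <| Eventually.of_forall fun n => (a (Nat.unpair n).1).2
  · intro hw
    rw [Metric.nhds_basis_ball.mapClusterPt_iff_frequently]
    intro ε hε
    obtain ⟨m, hm⟩ := ha.exists_dist_lt ⟨w, hw⟩ hε
    rw [frequently_atTop]
    intro N
    refine ⟨Nat.pair m N, Nat.right_le_pair m N, ?_⟩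
    rw [Nat.unpair_pair, Metric.mem_ball, dist_comm]
    exact hm

/-- The signed area spanned by three collinear points vanishes. -/
theorem Complex.cross_eq_zero_of_collinear {a b c : ℂ} (h : Collinear ℝ ({a, b, c} : Set ℂ)) :
    (b - a).re * (c - a).im = (b - a).im * (c - a).re := by
  rw [collinear_iff_of_mem (p₀ := a) (by simp)] at h
  obtain ⟨v, hv⟩ := h
  obtain ⟨r, rfl⟩ := hv b (by simp)
  obtain ⟨s, rfl⟩ := hv c (by simp)
  simp
  ring

theorem OnePoint.metrizableSpace_complex : TopologicalSpace.MetrizableSpace (OnePoint ℂ) :=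
  (onePointEquivSphereOfFinrankEq (ι := Fin 3) (V := ℂ)
    (by simp [Complex.finrank_real_complex])).isEmbedding.metrizableSpace

theorem Int.map_ediv_three_atTop : map (fun n : ℤ => n / 3) atTop = atTop :=
  map_atTop_eq_of_gc (fun n => 3 * n + 2) 0 (fun _ _ h => Int.ediv_le_ediv (by norm_num) h)
    (fun _ _ _ => by omega) (fun _ _ => by omega)

theorem Int.map_ediv_three_atBot : map (fun n : ℤ => n / 3) atBot = atBot :=
  map_atBot_eq_of_gc (fun n => 3 * n) 0 (fun _ _ h => Int.ediv_le_ediv (by norm_num) h)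
    (fun _ _ _ => by omega) (fun _ _ => by omega)

theorem Int.map_neg_natCast_atTop : map (fun n : ℕ => -(n : ℤ)) atTop = atBot := by
  rw [← Filter.map_neg_atTop, ← Nat.map_cast_int_atTop, Filter.map_map]
  rfl

theorem Int.tendsto_one_div_abs_add_one_atTop :
    Tendsto (fun m : ℤ => 1 / (|(m : ℝ)| + 1)) atTop (𝓝 0) := by
  simp_rw [one_div]
  exact (tendsto_atTop_add_const_right _ _
    (tendsto_abs_atTop_atTop.comp tendsto_intCast_atTop_atTop)).inv_tendsto_atTop

theorem Int.tendsto_one_div_abs_add_one_atBot :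
    Tendsto (fun m : ℤ => 1 / (|(m : ℝ)| + 1)) atBot (𝓝 0) := by
  have := Int.tendsto_one_div_abs_add_one_atTop.comp tendsto_neg_atBot_atTop
  simpa [Function.comp_def] using this

/-- The blocks `x, x + ε, x + ε + ε * I` replacing the points of `x : ℤ → ℂ`. -/
noncomputable def staircase (x : ℤ → ℂ) (ε : ℤ → ℝ) (n : ℤ) : ℂ :=
  if n % 3 = 0 then x (n / 3)
  else if n % 3 = 1 then x (n / 3) + ε (n / 3)
  else x (n / 3) + ε (n / 3) + ε (n / 3) * Complex.I

section staircase

variable (x : ℤ → ℂ) (ε : ℤ → ℝ) (m : ℤ)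

theorem staircase_three_mul : staircase x ε (3 * m) = x m := by
  simp [staircase]

theorem staircase_three_mul_add_one : staircase x ε (3 * m + 1) = x m + ε m := by
  have h1 : (3 * m + 1) % 3 = 1 := by omega
  have h2 : (3 * m + 1) / 3 = m := by omega
  simp [staircase, h1, h2]

theorem staircase_three_mul_add_two :
    staircase x ε (3 * m + 2) = x m + ε m + ε m * Complex.I := by
  have h1 : (3 * m + 2) % 3 = 2 := by omega
  have h2 : (3 * m + 2) / 3 = m := by omega
  simp [staircase, h1, h2]

theorem staircase_three_mul_add_three : staircase x ε (3 * m + 3) = x (m + 1) := by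
  rw [← staircase_three_mul x ε, mul_add, mul_one]

theorem staircase_three_mul_add_four :
    staircase x ε (3 * m + 4) = x (m + 1) + ε (m + 1) := by
  rw [← staircase_three_mul_add_one, mul_add, mul_one, add_assoc]
  rfl

end staircase

theorem Int.exists_eq_three_mul_add (n : ℤ) :
    ∃ m : ℤ, n = 3 * m ∨ n = 3 * m + 1 ∨ n = 3 * m + 2 :=
  ⟨n / 3, by omega⟩

theorem staircase_not_collinear {x : ℤ → ℂ} {ε : ℤ → ℝ} (hpos : ∀ m, 0 < ε m)
    (hre : ∀ m, ε m ≠ (x (m + 1) - x m).re) (him : ∀ m, ε m ≠ (x (m + 1) - x m).im) (n : ℤ) :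
    ¬ Collinear ℝ ({staircase x ε n, staircase x ε (n + 1), staircase x ε (n + 2)} : Set ℂ) := by
  intro h
  have key := Complex.cross_eq_zero_of_collinear h
  obtain ⟨m, rfl | rfl | rfl⟩ := Int.exists_eq_three_mul_add n
  · rw [staircase_three_mul, staircase_three_mul_add_one, staircase_three_mul_add_two] at key
    simp [(hpos m).ne'] at key
  · rw [show 3 * m + 1 + 1 = 3 * m + 2 by ring, show 3 * m + 1 + 2 = 3 * m + 3 by ring,
      staircase_three_mul_add_one, staircase_three_mul_add_two,
      staircase_three_mul_add_three] at key
    simp [(hpos m).ne'] at key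
    refine hre m ?_
    rw [Complex.sub_re]
    linarith
  · rw [show 3 * m + 2 + 1 = 3 * m + 3 by ring, show 3 * m + 2 + 2 = 3 * m + 4 by ring,
      staircase_three_mul_add_two, staircase_three_mul_add_three,
      staircase_three_mul_add_four] at key
    simp at key
    have h0 : ε (m + 1) * ((x (m + 1)).im - (x m).im - ε m) = 0 := by linear_combination -key
    have h1 := (mul_eq_zero.mp h0).resolve_left (hpos _).ne'
    refine him m ?_
    rw [Complex.sub_im]
    linarith

/-- A two-sided sequence in `ℂ` with prescribed cluster sets `K⁻` at `-∞` and `K⁺` at `+∞`,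
no three consecutive points collinear, and, towards each end, subsequences with horizontal
(respectively vertical) following segments whose cluster sets are the whole corresponding
continuum. -/
theorem sequence_with_prescribed_cluster_sets
    (Kneg Kpos : Set (OnePoint ℂ))
    (hKnegC : IsCompact Kneg) (hKnegConn : IsConnected Kneg)
    (hKposC : IsCompact Kpos) (hKposConn : IsConnected Kpos) :
    ∃ p : ℤ → ℂ,
      -- (i) cluster sets at the two ends
      {w : OnePoint ℂ | MapClusterPt w atBot fun n : ℤ => ((p n : ℂ) : OnePoint ℂ)} = Kneg ∧
      {w : OnePoint ℂ | MapClusterPt w atTop fun n : ℤ => ((p n : ℂ) : OnePoint ℂ)} = Kpos ∧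
      -- (ii) no three consecutive points are collinear
      (∀ n : ℤ, ¬ Collinear ℝ ({p n, p (n + 1), p (n + 2)} : Set ℂ)) ∧
      -- (iii) horizontal and vertical subsequences towards +∞, clustering exactly on K⁺
      (∃ nk : ℕ → ℤ, StrictMono nk ∧ Tendsto nk atTop atTop ∧
        (∀ k, ∃ r : ℝ, 0 < r ∧ p (nk k + 1) - p (nk k) = (r : ℂ)) ∧
        {w : OnePoint ℂ | MapClusterPt w atTop fun k : ℕ => ((p (nk k) : ℂ) : OnePoint ℂ)}
          = Kpos) ∧
      (∃ nl : ℕ → ℤ, StrictMono nl ∧ Tendsto nl atTop atTop ∧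
        (∀ l, ∃ r : ℝ, 0 < r ∧ p (nl l + 1) - p (nl l) = (r : ℂ) * Complex.I) ∧
        {w : OnePoint ℂ | MapClusterPt w atTop fun l : ℕ => ((p (nl l) : ℂ) : OnePoint ℂ)}
          = Kpos) ∧
      -- (iv) horizontal and vertical subsequences towards -∞, clustering exactly on K⁻
      (∃ ni : ℕ → ℤ, StrictAnti ni ∧ Tendsto ni atTop atBot ∧
        (∀ i, ∃ r : ℝ, 0 < r ∧ p (ni i + 1) - p (ni i) = (r : ℂ)) ∧
        {w : OnePoint ℂ | MapClusterPt w atTop fun i : ℕ => ((p (ni i) : ℂ) : OnePoint ℂ)}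
          = Kneg) ∧
      (∃ nj : ℕ → ℤ, StrictAnti nj ∧ Tendsto nj atTop atBot ∧
        (∀ j, ∃ r : ℝ, 0 < r ∧ p (nj j + 1) - p (nj j) = (r : ℂ) * Complex.I) ∧
        {w : OnePoint ℂ | MapClusterPt w atTop fun j : ℕ => ((p (nj j) : ℂ) : OnePoint ℂ)}
          = Kneg) := by
  let _ : MetricSpace (OnePoint ℂ) :=
    @TopologicalSpace.metrizableSpaceMetric _ _ OnePoint.metrizableSpace_complex
  obtain ⟨cpos, hcpos⟩ := exists_seq_clusterSet_eq (OnePoint.denseRange_coe (X := ℂ))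
    hKposC.isClosed hKposConn.nonempty
  obtain ⟨cneg, hcneg⟩ := exists_seq_clusterSet_eq (OnePoint.denseRange_coe (X := ℂ))
    hKnegC.isClosed hKnegConn.nonempty
  let x : ℤ → ℂ := fun n => if 0 ≤ n then cpos n.natAbs else cneg n.natAbs
  have hxpos : {w : OnePoint ℂ | MapClusterPt w atTop fun m : ℤ => (x m : OnePoint ℂ)} = Kpos := by
    rw [← hcpos]
    ext w
    simp only [Set.mem_ofPred_eq, MapClusterPt]
    rw [← Nat.map_cast_int_atTop, Filter.map_map]
    simp [x, Function.comp_def]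
  have hxneg : {w : OnePoint ℂ | MapClusterPt w atBot fun m : ℤ => (x m : OnePoint ℂ)} = Kneg := by
    rw [← hcneg]
    ext w
    simp only [Set.mem_ofPred_eq, MapClusterPt]
    rw [← Int.map_neg_natCast_atTop, Filter.map_map]
    rw [Filter.map_congr]
    filter_upwards [eventually_gt_atTop 0] with n hn
    have : ¬ (0 ≤ -(n : ℤ)) := by omega
    simp only [x, Function.comp_apply, if_neg this, Int.natAbs_neg, Int.natAbs_natCast]
  have hε : ∀ m : ℤ, ∃ e : ℝ, 0 < e ∧ e ≠ (x (m + 1) - x m).re ∧ e ≠ (x (m + 1) - x m).im ∧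
      dist ((x m + e : ℂ) : OnePoint ℂ) (x m) < 1 / (|(m : ℝ)| + 1) ∧
      dist ((x m + e + e * Complex.I : ℂ) : OnePoint ℂ) (x m) < 1 / (|(m : ℝ)| + 1) := by
    intro m
    have hδ : 0 < 1 / (|(m : ℝ)| + 1) := by positivity
    have hne : ∀ r : ℝ, ∀ᶠ e in 𝓝[>] (0 : ℝ), e ≠ r := fun r =>
      (nhdsGT_le_nhdsNE 0).trans (nhdsNE_le_cofinite 0) (Set.finite_singleton r).compl_mem_cofinite
    have hnear : ∀ f : ℝ → ℂ, Continuous f → f 0 = x m →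
        ∀ᶠ e in 𝓝[>] (0 : ℝ), dist (f e : OnePoint ℂ) (x m) < 1 / (|(m : ℝ)| + 1) := by
      intro f hf h0
      have hc : Continuous fun e => (f e : OnePoint ℂ) := OnePoint.continuous_coe.comp hf
      have ht := hc.tendsto 0
      rw [h0] at ht
      exact (ht.mono_left nhdsWithin_le_nhds).eventually (Metric.ball_mem_nhds _ hδ)
    have hgt : ∀ᶠ e in 𝓝[>] (0 : ℝ), 0 < e := self_mem_nhdsWithin
    exact (hgt.and ((hne _).and ((hne _).and
      ((hnear (fun e => x m + e) (by fun_prop) (by simp)).and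
      (hnear (fun e => x m + e + e * Complex.I) (by fun_prop) (by simp)))))).exists
  choose ε hpos hre him hd1 hd2 using hε
  have hd : ∀ n : ℤ, dist (staircase x ε n : OnePoint ℂ) (x (n / 3)) ≤
      1 / (|((n / 3 : ℤ) : ℝ)| + 1) := by
    intro n
    unfold staircase
    split_ifs
    · rw [dist_self]; positivity
    · exact (hd1 _).le
    · exact (hd2 _).le
  have hcluster : ∀ {α : Type} {l : Filter α} {L : Filter ℤ} {φ : α → ℤ},
      map (fun a => φ a / 3) l = L → Tendsto (fun m : ℤ => 1 / (|(m : ℝ)| + 1)) L (𝓝 0) →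
      {w : OnePoint ℂ | MapClusterPt w l fun a => (staircase x ε (φ a) : OnePoint ℂ)} =
        {w : OnePoint ℂ | MapClusterPt w L fun m => (x m : OnePoint ℂ)} := by
    intro α l L φ hφ hL
    ext w
    have hdist : Tendsto (fun a => dist (staircase x ε (φ a) : OnePoint ℂ) (x (φ a / 3))) l
        (𝓝 0) :=
      squeeze_zero (fun _ => dist_nonneg) (fun a => hd (φ a)) (hL.comp hφ.le)
    simp only [Set.mem_ofPred_eq]
    rw [mapClusterPt_congr_of_tendsto_dist hdist, MapClusterPt, MapClusterPt, ← hφ,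
      Filter.map_map]
    rfl
  have hT := Int.tendsto_one_div_abs_add_one_atTop
  have hB := Int.tendsto_one_div_abs_add_one_atBot
  have hcast : Tendsto (fun k : ℕ => (k : ℤ)) atTop atTop := tendsto_natCast_atTop_atTop
  have hneg : Tendsto (fun k : ℕ => -(k : ℤ)) atTop atBot := Int.map_neg_natCast_atTop.le
  have hright : ∀ m : ℤ, ∃ r : ℝ, 0 < r ∧
      staircase x ε (3 * m + 1) - staircase x ε (3 * m) = (r : ℂ) := fun m =>
    ⟨ε m, hpos m, by rw [staircase_three_mul, staircase_three_mul_add_one]; ring⟩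
  have hup : ∀ m : ℤ, ∃ r : ℝ, 0 < r ∧
      staircase x ε (3 * m + 1 + 1) - staircase x ε (3 * m + 1) = (r : ℂ) * Complex.I := fun m =>
    ⟨ε m, hpos m, by
      rw [show 3 * m + 1 + 1 = 3 * m + 2 by ring, staircase_three_mul_add_one,
        staircase_three_mul_add_two]
      ring⟩
  have hdiv0 : ∀ m : ℤ, 3 * m / 3 = m := fun m => by omega
  have hdiv1 : ∀ m : ℤ, (3 * m + 1) / 3 = m := fun m => by omega
  refine ⟨staircase x ε, ?_, ?_, staircase_not_collinear hpos hre him,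
    ⟨fun k => 3 * (k : ℤ), ?_, ?_, fun k => hright k, ?_⟩,
    ⟨fun k => 3 * (k : ℤ) + 1, ?_, ?_, fun k => hup k, ?_⟩,
    ⟨fun k => 3 * (-(k : ℤ)), ?_, ?_, fun k => hright (-k), ?_⟩,
    ⟨fun k => 3 * (-(k : ℤ)) + 1, ?_, ?_, fun k => hup (-k), ?_⟩⟩
  · exact (hcluster (φ := id) Int.map_ediv_three_atBot hB).trans hxneg
  · exact (hcluster (φ := id) Int.map_ediv_three_atTop hT).trans hxpos
  · intro a b h
    dsimp only
    omega
  · exact tendsto_atTop_mono (fun k => by omega) hcast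
  · exact (hcluster (by simp only [hdiv0]; exact Nat.map_cast_int_atTop) hT).trans hxpos
  · intro a b h
    dsimp only
    omega
  · exact tendsto_atTop_mono (fun k => by omega) hcast
  · exact (hcluster (by simp only [hdiv1]; exact Nat.map_cast_int_atTop) hT).trans hxpos
  · intro a b h
    dsimp only
    omega
  · exact tendsto_atBot_mono (fun k => by omega) hneg
  · exact (hcluster (by simp only [hdiv0]; exact Int.map_neg_natCast_atTop) hB).trans hxneg
  · intro a b h
    dsimp only
    omega
  · exact tendsto_atBot_mono (fun k => by omega)
      (tendsto_atBot_add_const_right _ (1 : ℤ) hneg)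
  · exact (hcluster (by simp only [hdiv1]; exact Int.map_neg_natCast_atTop) hB).trans hxneg
end

section
/- For any two continua K⁻ and K⁺ in the Riemann sphere, there exists a continuous polygonal curve η : ℝ → ℂ, affine on each interval [n, n+1] (n ∈ ℤ), i.e. η(t) = η(n) + (t − n)·(η(n+1) − η(n)) for t ∈ [n, n+1], such that: (i) no three consecutive nodes η(n), η(n+1), η(n+2) are collinear; (ii) the cluster set of η at −∞ equals K⁻ and the cluster set of η at +∞ equals K⁺; (iii) there are sequences of reals s(k) → +∞ and s(ℓ) → +∞ at which η is differentiable with derivative a positive real number at each s(k) and a positive multiple of i at each s(ℓ), such that the cluster sets (in OnePoint ℂ) of the sequences k ↦ η(s(k)) and ℓ ↦ η(s(ℓ)) both equal K⁺; (iv) analogously there are sequences tending to −∞ with horizontal, respectively vertical, nonvanishing derivative whose image sequences both have cluster set exactly K⁻. -/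
open Filter Topology

/-- Concatenation of finite chains: if in each phase `k` every admissible state can be driven by a
nonempty `R k`-chain to the goal `G k`, there is an infinite path running through all phases and
reaching all the goals. -/
theorem exists_seq_of_phases {S : Type*} (R : ℕ → S → S → Prop) (P G : ℕ → S → Prop) (s₀ : S)
    (h₀ : P 0 s₀) (hGP : ∀ k s, G k s → P (k + 1) s)
    (h : ∀ k s, P k s → ∃ t, Relation.TransGen (R k) s t ∧ G k t) :
    ∃ (σ : ℕ → S) (φ τ : ℕ → ℕ), σ 0 = s₀ ∧ Tendsto φ atTop atTop ∧ Tendsto τ atTop atTop ∧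
      (∀ n, R (φ n) (σ n) (σ (n + 1))) ∧ ∀ k, G k (σ (τ k)) := by
  let Q : ℕ → ℕ → S → Prop := fun k n => Nat.rec (fun s => ∃ t, R k s t ∧ G k t)
    (fun _ q s => ∃ t, R k s t ∧ q t) n
  have hQ : ∀ k s, P k s → ∃ n, Q k n s := by
    intro k s hs
    obtain ⟨t, hst, ht⟩ := h k s hs
    clear hs
    induction hst using Relation.TransGen.head_induction_on with
    | single h' => exact ⟨0, _, h', ht⟩
    | head h' _ ih =>
      obtain ⟨n, hn⟩ := ih
      exact ⟨n + 1, _, h', hn⟩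
  let X := {x : ℕ × ℕ × S // Q x.1 x.2.1 x.2.2}
  have step : ∀ x : X, ∃ y : X, R x.1.1 x.1.2.2 y.1.2.2 ∧
      ((x.1.2.1 = 0 ∧ y.1.1 = x.1.1 + 1 ∧ G x.1.1 y.1.2.2) ∨
        (x.1.2.1 = y.1.2.1 + 1 ∧ y.1.1 = x.1.1)) := by
    rintro ⟨⟨k, n, s⟩, hx⟩
    cases n with
    | zero =>
      obtain ⟨t, hst, ht⟩ := hx
      obtain ⟨m, hm⟩ := hQ (k + 1) t (hGP k t ht)
      exact ⟨⟨(k + 1, m, t), hm⟩, hst, Or.inl ⟨rfl, rfl, ht⟩⟩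
    | succ n =>
      obtain ⟨t, hst, ht⟩ := hx
      exact ⟨⟨(k, n, t), ht⟩, hst, Or.inr ⟨rfl, rfl⟩⟩
  choose next hR hnext using step
  obtain ⟨m, hm⟩ := hQ 0 s₀ h₀
  let x : ℕ → X := fun n => next^[n] ⟨(0, m, s₀), hm⟩
  have hx : ∀ n, x (n + 1) = next (x n) := fun n => Function.iterate_succ_apply' _ _ _
  have reach : ∀ n i, (x i).1.2.1 = n → ∃ j, (x j).1.1 = (x i).1.1 ∧ (x j).1.2.1 = 0 := by
    intro n
    induction n with
    | zero => exact fun i hi => ⟨i, rfl, hi⟩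
    | succ n ih =>
      intro i hi
      have := hnext (x i)
      rw [← hx] at this
      obtain ⟨j, hj, hj'⟩ := ih (i + 1) (by omega)
      exact ⟨j, by omega, hj'⟩
  have reach' : ∀ k, ∃ i, (x i).1.1 = k ∧ (x i).1.2.1 = 0 := by
    intro k
    induction k with
    | zero => exact reach _ 0 rfl
    | succ k ih =>
      obtain ⟨i, hi, hi'⟩ := ih
      have := hnext (x i)
      rw [← hx] at this
      obtain ⟨j, hj, hj'⟩ := reach _ (i + 1) rfl
      exact ⟨j, by omega, hj'⟩
  choose ρ hρ hρ' using reach'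
  have hmono : Monotone fun n => (x n).1.1 := by
    refine monotone_nat_of_le_succ fun n => ?_
    have := hnext (x n)
    rw [← hx] at this
    omega
  have hle : ∀ n, (x n).1.1 ≤ n := by
    intro n
    induction n with
    | zero => exact le_rfl
    | succ n ih =>
      have := hnext (x n)
      rw [← hx] at this
      omega
  refine ⟨fun n => (x n).1.2.2, fun n => (x n).1.1, fun k => ρ k + 1, rfl,
    tendsto_atTop_atTop_of_monotone hmono fun k => ⟨ρ k, (hρ k).ge⟩,
    tendsto_atTop_mono (fun k => ?_) tendsto_id, fun n => ?_, fun k => ?_⟩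
  · have := hle (ρ k)
    rw [hρ] at this
    exact this.trans (Nat.le_succ _)
  · change R _ _ (x (n + 1)).1.2.2
    rw [hx]
    exact hR _
  · have := hnext (x (ρ k))
    rw [← hx, hρ, hρ'] at this
    rcases this with h | h
    · exact h.2.2
    · omega

/-- The cross product (signed area) of two plane vectors. -/
def cross (u v : ℂ) : ℝ := u.re * v.im - u.im * v.re

/-- A state `(a, b)` is the last segment of a polygonal curve; a step appends a segment that lies in
`U` and is not parallel to the last one. -/
def PolyStep (U : Set ℂ) (s t : ℂ × ℂ) : Prop :=
  t.1 = s.2 ∧ cross (s.2 - s.1) (t.2 - t.1) ≠ 0 ∧ segment ℝ t.1 t.2 ⊆ U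

theorem not_collinear_of_cross_ne_zero {a b c : ℂ} (h : cross (b - a) (c - b) ≠ 0) :
    ¬ Collinear ℝ ({a, b, c} : Set ℂ) := by
  intro hc
  obtain ⟨v, hv⟩ := (collinear_iff_of_mem (p₀ := a) (by simp)).1 hc
  obtain ⟨r, rfl⟩ := hv b (by simp)
  obtain ⟨s, rfl⟩ := hv c (by simp)
  apply h
  simp [cross]
  ring

theorem ne_of_cross_ne_zero {a b u : ℂ} (h : cross u (b - a) ≠ 0) : a ≠ b := by
  rintro rfl
  simp [cross] at h

theorem exists_mem_cross_ne_zero {N : Set ℂ} {e : ℂ} (hN : N ∈ 𝓝 e) {a b : ℂ} (hab : a ≠ b) :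
    ∃ e' ∈ N, cross (b - a) (e' - b) ≠ 0 := by
  by_cases h : cross (b - a) (e - b) = 0
  · have ht : Tendsto (fun δ : ℝ => e + δ * (Complex.I * (b - a))) (𝓝[>] 0) (𝓝 e) := by
      have : Continuous (fun δ : ℝ => e + δ * (Complex.I * (b - a))) := by fun_prop
      simpa using (this.tendsto 0).mono_left nhdsWithin_le_nhds
    obtain ⟨δ, hδ, hδ0 : 0 < δ⟩ := ((ht.eventually hN).and self_mem_nhdsWithin).exists
    refine ⟨_, hδ, ?_⟩
    have key : cross (b - a) (e + δ * (Complex.I * (b - a)) - b)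
        = cross (b - a) (e - b) + δ * Complex.normSq (b - a) := by
      simp [cross, Complex.normSq_apply]; ring
    rw [key, h, zero_add]
    exact mul_ne_zero hδ0.ne' (by simpa [sub_eq_zero] using hab.symm)
  · exact ⟨e, mem_of_mem_nhds hN, h⟩

/-- Segments with endpoints close to those of a segment in an open set stay in that set. -/
theorem eventually_segment_subset {U : Set ℂ} (hU : IsOpen U) {c e : ℂ} (h : segment ℝ c e ⊆ U) :
    ∀ᶠ q : ℂ × ℂ in 𝓝 (c, e), segment ℝ q.1 q.2 ⊆ U := by
  have hcont : Continuous fun r : (ℂ × ℂ) × ℝ => r.1.1 + r.2 • (r.1.2 - r.1.1) := by fun_prop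
  have := isCompact_Icc.eventually_forall_of_forall_eventually (x₀ := (c, e))
    (K := Set.Icc (0 : ℝ) 1) (P := fun q θ => q.1 + θ • (q.2 - q.1) ∈ U) (by
      intro θ hθ
      exact hcont.continuousAt.eventually_mem (hU.mem_nhds (h (by
        rw [segment_eq_image']; exact ⟨θ, hθ, rfl⟩))))
  filter_upwards [this] with q hq
  rw [segment_eq_image']
  rintro _ ⟨θ, hθ, rfl⟩
  exact hq θ hθ

theorem exists_polyStep_near {U : Set ℂ} (hU : IsOpen U) {a b c : ℂ} (hab : a ≠ b)
    (h : Relation.ReflTransGen (fun y z => segment ℝ y z ⊆ U) b c) :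
    ∀ N ∈ 𝓝 c, ∃ a' b', Relation.ReflTransGen (PolyStep U) (a, b) (a', b') ∧ a' ≠ b' ∧ b' ∈ N := by
  induction h with
  | refl => exact fun N hN => ⟨a, b, .refl, hab, mem_of_mem_nhds hN⟩
  | @tail c e _ hce ih =>
    intro N hN
    obtain ⟨M, hM, N', hN', hMN⟩ := mem_nhds_prod_iff.1 (eventually_segment_subset hU hce)
    obtain ⟨a', b', hchain, hne, hb'⟩ := ih M hM
    obtain ⟨e', he', hcr⟩ := exists_mem_cross_ne_zero (inter_mem hN hN') hne
    exact ⟨b', e', hchain.tail ⟨rfl, hcr, hMN (Set.mk_mem_prod hb' he'.2)⟩,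
      ne_of_cross_ne_zero hcr, he'.1⟩

theorem exists_cross_ne_zero {u d : ℂ} (hu : u ≠ 0) (hd : d ≠ 0) :
    ∃ h, cross u h ≠ 0 ∧ cross h d ≠ 0 := by
  have hu' : Complex.normSq u ≠ 0 := by simpa using hu
  by_cases h : cross (Complex.I * u) d = 0
  · refine ⟨Complex.I * u + u, ?_, ?_⟩
    · convert hu' using 1
      simp [cross, Complex.normSq_apply]; ring
    · intro h'
      apply mul_ne_zero hu' (show Complex.normSq d ≠ 0 by simpa using hd)
      simp [cross] at h h'
      rw [Complex.normSq_apply, Complex.normSq_apply]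
      have h2 : u.re * d.im - u.im * d.re = 0 := by linarith
      linear_combination (-u.im * d.im - u.re * d.re) * h + (u.re * d.im - u.im * d.re) * h2
  · refine ⟨Complex.I * u, ?_, h⟩
    convert hu' using 1
    simp [cross, Complex.normSq_apply]

theorem exists_polyStep_direction {U O : Set ℂ} (hU : IsOpen U) (hO : IsOpen O) (hOU : O ⊆ U)
    {a b c d : ℂ} (hab : a ≠ b) (hd : d ≠ 0) (hc : c ∈ O)
    (h : Relation.ReflTransGen (fun y z => segment ℝ y z ⊆ U) b c) :
    ∃ t : ℂ × ℂ, Relation.TransGen (PolyStep U) (a, b) t ∧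
      (∃ r : ℝ, 0 < r ∧ t.2 - t.1 = r * d) ∧ segment ℝ t.1 t.2 ⊆ O := by
  obtain ⟨a', b', hchain, hne, hb'⟩ := exists_polyStep_near hU hab h O (hO.mem_nhds hc)
  obtain ⟨v, hv, hv'⟩ := exists_cross_ne_zero (sub_ne_zero.2 hne.symm) hd
  obtain ⟨ε, hε, hball⟩ := Metric.isOpen_iff.1 hO b' hb'
  have h1 : Tendsto (fun δ : ℝ => b' + δ * v) (𝓝[>] 0) (𝓝 b') := by
    have : Continuous (fun δ : ℝ => b' + δ * v) := by fun_prop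
    simpa using (this.tendsto 0).mono_left nhdsWithin_le_nhds
  have h2 : Tendsto (fun δ : ℝ => b' + δ * v + δ * d) (𝓝[>] 0) (𝓝 b') := by
    have : Continuous (fun δ : ℝ => b' + δ * v + δ * d) := by fun_prop
    simpa using (this.tendsto 0).mono_left nhdsWithin_le_nhds
  obtain ⟨δ, ⟨hδ1, hδ2⟩, hδ0 : 0 < δ⟩ := (((h1.eventually (Metric.ball_mem_nhds _ hε)).and
    (h2.eventually (Metric.ball_mem_nhds _ hε))).and self_mem_nhdsWithin).exists
  have hs1 : segment ℝ b' (b' + δ * v) ⊆ O :=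
    ((convex_ball b' ε).segment_subset (Metric.mem_ball_self hε) hδ1).trans hball
  have hs2 : segment ℝ (b' + δ * v) (b' + δ * v + δ * d) ⊆ O :=
    ((convex_ball b' ε).segment_subset hδ1 hδ2).trans hball
  have e1 : cross (b' - a') (b' + δ * v - b') = δ * cross (b' - a') v := by
    simp [cross]; ring
  have e2 : cross (b' + δ * v - b') (b' + δ * v + δ * d - (b' + δ * v)) = δ * δ * cross v d := by
    simp [cross]; ring
  refine ⟨(b' + δ * v, b' + δ * v + δ * d), ?_, ⟨δ, hδ0, by ring⟩, hs2⟩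
  refine Relation.TransGen.tail (b := (b', b' + δ * v)) (Relation.TransGen.tail' hchain ?_) ?_
  · exact ⟨rfl, by simp only [e1]; exact mul_ne_zero hδ0.ne' hv, hs1.trans hOU⟩
  · exact ⟨rfl, by simp only [e2]; exact mul_ne_zero (mul_pos hδ0 hδ0).ne' hv', hs2.trans hOU⟩

instance : TopologicalSpace.MetrizableSpace (OnePoint ℂ) :=
  (onePointEquivSphereOfFinrankEq (ι := Fin 3) (V := ℂ)
    (by simp [Complex.finrank_real_complex])).isEmbedding.metrizableSpace

theorem exists_antitone_nhds_and_recurrent_open_sets {X : Type*} [TopologicalSpace X]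
    [TopologicalSpace.MetrizableSpace X] {K : Set X} (hK : IsCompact K) (hne : K.Nonempty) :
    ∃ U O : ℕ → Set X, (𝓝ˢ K).HasAntitoneBasis U ∧ (∀ k, IsOpen (O k)) ∧
      (∀ k, (O k ∩ K).Nonempty) ∧ ∀ y ∈ K, ∀ N ∈ 𝓝 y, ∃ᶠ k in atTop, O k ⊆ N := by
  let := TopologicalSpace.metrizableSpaceMetric X
  have : CompactSpace K := isCompact_iff_compactSpace.1 hK
  have : Nonempty K := hne.to_subtype
  let y : ℕ → K := TopologicalSpace.denseSeq K
  refine ⟨fun k => Metric.thickening (1 / ((k : ℝ) + 1)) K,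
    fun k => Metric.ball (y k.unpair.1 : X) (1 / ((k : ℝ) + 1)), ⟨⟨fun t => ?_⟩, ?_⟩,
    fun k => Metric.isOpen_ball, fun k => ⟨y k.unpair.1, ?_, (y _).2⟩, ?_⟩
  · constructor
    · intro ht
      obtain ⟨s, hs, hKs, hst⟩ := mem_nhdsSet_iff_exists.1 ht
      obtain ⟨δ, hδ, h⟩ := hK.exists_thickening_subset_open hs hKs
      obtain ⟨k, hk⟩ := exists_nat_one_div_lt hδ
      exact ⟨k, trivial, ((Metric.thickening_mono hk.le K).trans h).trans hst⟩
    · rintro ⟨k, -, h⟩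
      exact mem_of_superset (Metric.isOpen_thickening.mem_nhdsSet.2
        (Metric.self_subset_thickening Nat.one_div_pos_of_nat K)) h
  · exact fun i j hij => Metric.thickening_mono (Nat.one_div_le_one_div hij) K
  · exact Metric.mem_ball_self Nat.one_div_pos_of_nat
  · intro z hz N hN
    obtain ⟨ε, hε, hball⟩ := Metric.mem_nhds_iff.1 hN
    obtain ⟨i, hi⟩ := (TopologicalSpace.denseRange_denseSeq K).exists_dist_lt ⟨z, hz⟩
      (half_pos hε)
    obtain ⟨m, hm⟩ := exists_nat_one_div_lt (half_pos hε)
    refine frequently_atTop.2 fun a => ⟨Nat.pair i (max a m), ?_, ?_⟩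
    · exact (le_max_left _ _).trans (Nat.right_le_pair _ _)
    · refine Set.Subset.trans ?_ hball
      have h1 : 1 / ((Nat.pair i (max a m) : ℕ) + 1 : ℝ) ≤ 1 / ((m : ℝ) + 1) :=
        Nat.one_div_le_one_div ((le_max_right _ _).trans (Nat.right_le_pair _ _))
      refine Metric.ball_subset_ball' ?_
      rw [Nat.unpair_pair, dist_comm]
      have h2 : dist z (y i) < ε / 2 := hi
      simp only
      linarith

/-- Connectability by polygonal curves inside `U`, where `U` is a subset of the sphere. -/
def PolyJoined (U : Set (OnePoint ℂ)) : ℂ → ℂ → Prop :=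
  Relation.ReflTransGen fun y z => segment ℝ y z ⊆ (↑) ⁻¹' U

theorem PolyJoined.symm {U : Set (OnePoint ℂ)} {a b : ℂ} (h : PolyJoined U a b) :
    PolyJoined U b a := by
  have : Std.Symm fun y z : ℂ => segment ℝ y z ⊆ ((↑) : ℂ → OnePoint ℂ) ⁻¹' U :=
    ⟨fun y z h => by rwa [segment_symm]⟩
  exact Std.Symm.symm (r := Relation.ReflTransGen _) _ _ h

theorem PolyJoined.of_convex {U : Set (OnePoint ℂ)} {C : Set ℂ} (hC : Convex ℝ C)
    (hCU : C ⊆ (↑) ⁻¹' U) {a b : ℂ} (ha : a ∈ C) (hb : b ∈ C) : PolyJoined U a b :=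
  .single ((hC.segment_subset ha hb).trans hCU)

theorem exists_nhds_polyJoined (w : OnePoint ℂ) {U : Set (OnePoint ℂ)} (hU : U ∈ 𝓝 w) :
    ∃ W ∈ 𝓝 w, ∀ a b : ℂ, (a : OnePoint ℂ) ∈ W → (b : OnePoint ℂ) ∈ W → PolyJoined U a b := by
  induction w using OnePoint.rec with
  | coe z =>
    rw [OnePoint.nhds_coe_eq] at hU
    obtain ⟨ε, hε, hball⟩ := Metric.mem_nhds_iff.1 hU
    refine ⟨(↑) '' Metric.ball z ε, ?_, fun a b ha hb => ?_⟩
    · rw [OnePoint.nhds_coe_eq]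
      exact image_mem_map (Metric.ball_mem_nhds z hε)
    · exact .of_convex (convex_ball z ε) hball
        (by simpa using ha) (by simpa using hb)
  | infty =>
    obtain ⟨C, ⟨-, hC⟩, hCU⟩ := OnePoint.hasBasis_nhds_infty.mem_iff.1 hU
    obtain ⟨R, hR⟩ := hC.isBounded.subset_closedBall 0
    have hout : ∀ z : ℂ, R < ‖z‖ → (z : OnePoint ℂ) ∈ U := fun z hz =>
      hCU (Or.inl ⟨z, fun hzC => hz.not_ge (by simpa using hR hzC), rfl⟩)
    have hre : ∀ z : ℂ, z.re ≤ ‖z‖ := fun z => Complex.re_le_norm z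
    have him : ∀ z : ℂ, z.im ≤ ‖z‖ := fun z => (le_abs_self _).trans (Complex.abs_im_le_norm z)
    have hre' : ∀ z : ℂ, -z.re ≤ ‖z‖ := fun z => (neg_le_abs _).trans (Complex.abs_re_le_norm z)
    have him' : ∀ z : ℂ, -z.im ≤ ‖z‖ := fun z => (neg_le_abs _).trans (Complex.abs_im_le_norm z)
    let H₁ : Set ℂ := {z | R < z.re}
    let H₂ : Set ℂ := {z | R < z.im}
    let H₃ : Set ℂ := {z | z.re < -R}
    let H₄ : Set ℂ := {z | z.im < -R}
    have c₁ : H₁ ⊆ (↑) ⁻¹' U := fun z hz => hout z (lt_of_lt_of_le hz (hre z))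
    have c₂ : H₂ ⊆ (↑) ⁻¹' U := fun z hz => hout z (lt_of_lt_of_le hz (him z))
    have c₃ : H₃ ⊆ (↑) ⁻¹' U := fun z hz => hout z (lt_of_lt_of_le (lt_neg_of_lt_neg hz) (hre' z))
    have c₄ : H₄ ⊆ (↑) ⁻¹' U := fun z hz => hout z (lt_of_lt_of_le (lt_neg_of_lt_neg hz) (him' z))
    have v₁ : Convex ℝ H₁ := convex_halfSpace_re_gt R
    have v₂ : Convex ℝ H₂ := convex_halfSpace_im_gt R
    have v₃ : Convex ℝ H₃ := convex_halfSpace_re_lt (-R)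
    have v₄ : Convex ℝ H₄ := convex_halfSpace_im_lt (-R)
    have key : ∀ z : ℂ, z ∉ Set.Icc (-R) R ×ℂ Set.Icc (-R) R →
        PolyJoined U z ⟨R + 1, R + 1⟩ := by
      intro z hz
      have hz' : z ∈ H₁ ∨ z ∈ H₂ ∨ z ∈ H₃ ∨ z ∈ H₄ := by
        by_contra! h
        simp only [H₁, H₂, H₃, H₄, Set.mem_ofPred_eq, not_lt] at h
        exact hz ⟨⟨h.2.2.1, h.1⟩, h.2.2.2, h.2.1⟩
      rcases hz' with h | h | h | h
      · exact .of_convex v₁ c₁ h (by simp [H₁])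
      · exact .of_convex v₂ c₂ h (by simp [H₂])
      · exact (PolyJoined.of_convex v₃ c₃ h (b := ⟨-(R + 1), R + 1⟩) (by simp [H₃])).trans
          (PolyJoined.of_convex v₂ c₂ (by simp [H₂]) (by simp [H₂]))
      · exact (PolyJoined.of_convex v₄ c₄ h (b := ⟨R + 1, -(R + 1)⟩) (by simp [H₄])).trans
          (PolyJoined.of_convex v₁ c₁ (by simp [H₁]) (by simp [H₁]))
    have hQ : IsCompact (Set.Icc (-R) R ×ℂ Set.Icc (-R) R) := isCompact_Icc.reProdIm isCompact_Icc
    refine ⟨((↑) '' (Set.Icc (-R) R ×ℂ Set.Icc (-R) R))ᶜ,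
      (OnePoint.isOpen_compl_image_coe.2 ⟨hQ.isClosed, hQ⟩).mem_nhds (by simp),
      fun a b ha hb => ?_⟩
    have ha' : a ∉ Set.Icc (-R) R ×ℂ Set.Icc (-R) R := fun h => ha ⟨a, h, rfl⟩
    have hb' : b ∉ Set.Icc (-R) R ×ℂ Set.Icc (-R) R := fun h => hb ⟨b, h, rfl⟩
    exact (key a ha').trans (key b hb').symm

theorem exists_coe_mem_of_mem_nhds {w : OnePoint ℂ} {W : Set (OnePoint ℂ)} (hW : W ∈ 𝓝 w) :
    ∃ z : ℂ, (z : OnePoint ℂ) ∈ W := by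
  obtain ⟨_, ⟨z, rfl⟩, hz⟩ := OnePoint.denseRange_coe.inter_nhds_nonempty hW
  exact ⟨z, hz⟩

theorem exists_open_polyJoined {K U : Set (OnePoint ℂ)} (hK : IsPreconnected K)
    (hU : U ∈ 𝓝ˢ K) :
    ∃ V, IsOpen V ∧ K ⊆ V ∧
      ∀ a b : ℂ, (a : OnePoint ℂ) ∈ V → (b : OnePoint ℂ) ∈ V → PolyJoined U a b := by
  let P : OnePoint ℂ → OnePoint ℂ → Prop := fun x y => ∃ W ∈ 𝓝 x, ∃ W' ∈ 𝓝 y,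
    ∀ a b : ℂ, (a : OnePoint ℂ) ∈ W → (b : OnePoint ℂ) ∈ W' → PolyJoined U a b
  have hP : ∀ x ∈ K, ∀ y ∈ K, P x y := by
    intro x hx y hy
    refine hK.induction₂' P (fun x hx => ?_) (fun x y z _ _ _ hxy hyz => ?_) hx hy
    · obtain ⟨W, hW, h⟩ := exists_nhds_polyJoined x (mem_nhdsSet_iff_forall.1 hU x hx)
      filter_upwards [mem_nhdsWithin_of_mem_nhds (eventually_mem_nhds_iff.2 hW)] with y hy
      exact ⟨⟨W, hW, W, hy, h⟩, ⟨W, hy, W, hW, h⟩⟩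
    · obtain ⟨W₁, hW₁, W₂, hW₂, h⟩ := hxy
      obtain ⟨W₃, hW₃, W₄, hW₄, h'⟩ := hyz
      obtain ⟨c, hc⟩ := exists_coe_mem_of_mem_nhds (inter_mem hW₂ hW₃)
      exact ⟨W₁, hW₁, W₄, hW₄, fun a b ha hb => (h a c ha hc.1).trans (h' c b hc.2 hb)⟩
  have hloc : ∀ x : K, ∃ W, IsOpen W ∧ (x : OnePoint ℂ) ∈ W ∧
      ∀ a b : ℂ, (a : OnePoint ℂ) ∈ W → (b : OnePoint ℂ) ∈ W → PolyJoined U a b := by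
    intro x
    obtain ⟨W, hW, h⟩ := exists_nhds_polyJoined x.1 (mem_nhdsSet_iff_forall.1 hU x x.2)
    obtain ⟨W', hW', ho, hx⟩ := mem_nhds_iff.1 hW
    exact ⟨W', ho, hx, fun a b ha hb => h a b (hW' ha) (hW' hb)⟩
  choose W hWo hxW hW using hloc
  refine ⟨⋃ x, W x, isOpen_iUnion hWo, fun x hx => Set.mem_iUnion.2 ⟨⟨x, hx⟩, hxW _⟩, ?_⟩
  intro a b ha hb
  obtain ⟨x, hx⟩ := Set.mem_iUnion.1 ha
  obtain ⟨y, hy⟩ := Set.mem_iUnion.1 hb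
  obtain ⟨N, hN, N', hN', h⟩ := hP x x.2 y y.2
  obtain ⟨c, hc⟩ := exists_coe_mem_of_mem_nhds (inter_mem hN ((hWo x).mem_nhds (hxW x)))
  obtain ⟨e, he⟩ := exists_coe_mem_of_mem_nhds (inter_mem hN' ((hWo y).mem_nhds (hxW y)))
  exact ((hW x a c hx hc.2).trans (h c e hc.1 he.1)).trans (hW y e b he.2 hy)

theorem exists_nodes {K : Set (OnePoint ℂ)} (hK : IsPreconnected K) {U O : ℕ → Set (OnePoint ℂ)}
    (hU : (𝓝ˢ K).HasAntitoneBasis U) (hO : ∀ k, IsOpen (O k)) (hOK : ∀ k, (O k ∩ K).Nonempty)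
    {d : ℕ → ℂ} (hd : ∀ k, d k ≠ 0) {u : ℂ} (hu : u ≠ 0) :
    ∃ (p : ℕ → ℂ) (τ : ℕ → ℕ), p 0 = 0 ∧ p 1 = u ∧
      (∀ n, cross (p (n + 1) - p n) (p (n + 2) - p (n + 1)) ≠ 0) ∧
      Tendsto τ atTop atTop ∧
      (∀ N ∈ 𝓝ˢ K, ∀ᶠ n in atTop, segment ℝ (p n) (p (n + 1)) ⊆ (↑) ⁻¹' N) ∧
      (∀ k, ∃ r : ℝ, 0 < r ∧ p (τ k + 1) - p (τ k) = r * d k) ∧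
      ∀ k, segment ℝ (p (τ k)) (p (τ k + 1)) ⊆ (↑) ⁻¹' O k := by
  -- a preliminary phase in the whole sphere leads from the initial segment to the first target
  let A : ℕ → Set (OnePoint ℂ) := fun k => Nat.casesOn k Set.univ fun k => interior (U k)
  have hA : ∀ k, IsOpen (A k) := by
    rintro (_ | k)
    · exact isOpen_univ
    · exact isOpen_interior
  have hKA : ∀ k, K ⊆ A k := by
    rintro (_ | k)
    · exact Set.subset_univ _
    · exact subset_interior_iff_mem_nhdsSet.2 (hU.mem k)
  have hV : ∀ k, ∃ V, IsOpen V ∧ K ⊆ V ∧ (k = 0 → V = Set.univ) ∧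
      ∀ a b : ℂ, (a : OnePoint ℂ) ∈ V → (b : OnePoint ℂ) ∈ V → PolyJoined (A k) a b := by
    rintro (_ | k)
    · exact ⟨Set.univ, isOpen_univ, Set.subset_univ _, fun _ => rfl,
        fun a b _ _ => .single (Set.subset_univ _)⟩
    · obtain ⟨V, hVo, hKV, hV⟩ := exists_open_polyJoined hK ((hA (k + 1)).mem_nhdsSet.2 (hKA (k + 1)))
      exact ⟨V, hVo, hKV, by simp, hV⟩
  choose V hVo hKV hV0 hV using hV
  let T : ℕ → Set (OnePoint ℂ) := fun k => O k ∩ (A k ∩ (V k ∩ V (k + 1)))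
  have hT : ∀ k, IsOpen (T k) := fun k =>
    (hO k).inter ((hA k).inter ((hVo k).inter (hVo (k + 1))))
  have hTc : ∀ k, ∃ c : ℂ, (c : OnePoint ℂ) ∈ T k := by
    intro k
    obtain ⟨y, hy, hyK⟩ := hOK k
    exact exists_coe_mem_of_mem_nhds
      ((hT k).mem_nhds ⟨hy, hKA k hyK, hKV k hyK, hKV (k + 1) hyK⟩)
  obtain ⟨σ, φ, τ, hσ0, hφ, hτ, hσ, hG⟩ := exists_seq_of_phases
    (fun k => PolyStep ((↑) ⁻¹' A k))
    (fun k s => s.1 ≠ s.2 ∧ ((s.2 : ℂ) : OnePoint ℂ) ∈ V k)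
    (fun k s => s.1 ≠ s.2 ∧ (∃ r : ℝ, 0 < r ∧ s.2 - s.1 = r * d k) ∧
      segment ℝ s.1 s.2 ⊆ (↑) ⁻¹' T k)
    ((0 : ℂ), u) ⟨hu.symm, by rw [hV0 0 rfl]; trivial⟩
    (fun k s hs => ⟨hs.1, (hs.2.2 (right_mem_segment ℝ _ _)).2.2.2⟩) (by
      rintro k ⟨a, b⟩ ⟨hab, hb⟩
      obtain ⟨c, hc⟩ := hTc k
      obtain ⟨t, ht, ⟨r, hr, hrt⟩, hs⟩ := exists_polyStep_direction
        ((hA k).preimage OnePoint.continuous_coe) ((hT k).preimage OnePoint.continuous_coe)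
        (fun z hz => hz.2.1) hab (hd k) hc (hV k b c hb hc.2.2.1)
      refine ⟨t, ht, ?_, ⟨r, hr, hrt⟩, hs⟩
      intro h
      rw [h, sub_self, eq_comm, mul_eq_zero] at hrt
      exact hrt.elim (by exact_mod_cast hr.ne') (hd k))
  have hsnd : ∀ n, (σ n).2 = (σ (n + 1)).1 := fun n => (hσ n).1.symm
  refine ⟨fun n => (σ n).1, τ, congrArg Prod.fst hσ0, ?_, fun n => ?_, hτ, fun N hN => ?_, fun k => ?_,
    fun k => ?_⟩
  · change (σ (0 + 1)).1 = u
    rw [← hsnd, hσ0]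
  · have h := (hσ n).2.1
    rwa [hsnd n, hsnd (n + 1)] at h
  · obtain ⟨k, hk⟩ := hU.mem_iff.1 hN
    obtain ⟨m, hm⟩ := eventually_atTop.1 (hφ.eventually_ge_atTop (k + 1))
    refine eventually_atTop.2 ⟨m + 1, fun n hn => ?_⟩
    obtain ⟨n, rfl⟩ := Nat.exists_eq_add_of_le' (Nat.one_le_of_lt hn)
    obtain ⟨i, hi⟩ := Nat.exists_eq_add_of_le' (hm n (by omega))
    have h := (hσ n).2.2
    rw [hsnd (n + 1), hi] at h
    exact h.trans fun z hz => hk (hU.antitone (Nat.le_add_left k i) (interior_subset hz))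
  · have h := (hG k).2.1
    rwa [hsnd] at h
  · have h := (hG k).2.2
    rw [hsnd] at h
    exact h.trans fun z hz => hz.1

/-- The polygonal curve with nodes `v n` at the integers. -/
noncomputable def polyline (v : ℤ → ℂ) (t : ℝ) : ℂ :=
  v ⌊t⌋ + ((t - ⌊t⌋ : ℝ) : ℂ) * (v (⌊t⌋ + 1) - v ⌊t⌋)

theorem polyline_intCast (v : ℤ → ℂ) (n : ℤ) : polyline v n = v n := by
  simp [polyline]

theorem polyline_eq (v : ℤ → ℂ) {n : ℤ} {t : ℝ} (ht : t ∈ Set.Icc (n : ℝ) ((n : ℝ) + 1)) :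
    polyline v t = v n + ((t - n : ℝ) : ℂ) * (v (n + 1) - v n) := by
  rcases ht.2.eq_or_lt with h | h
  · have : t = ((n + 1 : ℤ) : ℝ) := by push_cast; exact h
    rw [this, polyline_intCast]
    push_cast
    ring
  · rw [polyline, Int.floor_eq_iff.2 ⟨ht.1, h⟩]

theorem polyline_mem_segment (v : ℤ → ℂ) (t : ℝ) :
    polyline v t ∈ segment ℝ (v ⌊t⌋) (v (⌊t⌋ + 1)) := by
  rw [segment_eq_image']
  refine ⟨t - ⌊t⌋, ⟨sub_nonneg.2 (Int.floor_le t), ?_⟩, by simp [polyline]⟩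
  linarith [Int.lt_floor_add_one t]

theorem continuous_polyline (v : ℤ → ℂ) : Continuous (polyline v) := by
  have key : ∀ n : ℤ, ContinuousOn (polyline v) (Set.Icc (n : ℝ) ((n : ℝ) + 1)) := fun n =>
    ContinuousOn.congr (f := fun t : ℝ => v n + ((t - n : ℝ) : ℂ) * (v (n + 1) - v n))
      (by fun_prop) fun t ht => polyline_eq v ht
  refine continuous_iff_continuousAt.2 fun t => continuousAt_iff_continuous_left_right.2 ⟨?_, ?_⟩
  · have hl := Int.ceil_lt_add_one t
    have hr := Int.le_ceil t
    have h := key (⌈t⌉ - 1)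
    push_cast at h
    refine (h t ⟨by linarith, by linarith⟩).mono_of_mem_nhdsWithin ?_
    exact mem_of_superset (Icc_mem_nhdsLE (show (⌈t⌉ : ℝ) - 1 < t by linarith))
      (Set.Icc_subset_Icc_right (by linarith))
  · have hl := Int.floor_le t
    have hr := Int.lt_floor_add_one t
    refine (key ⌊t⌋ t ⟨hl, hr.le⟩).mono_of_mem_nhdsWithin ?_
    exact mem_of_superset (Icc_mem_nhdsGE hr) (Set.Icc_subset_Icc_left hl)

theorem hasDerivAt_polyline (v : ℤ → ℂ) (n : ℤ) :
    HasDerivAt (polyline v) (v (n + 1) - v n) ((n : ℝ) + 1 / 2) := by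
  have h : HasDerivAt (fun t : ℝ => v n + ((t - n : ℝ) : ℂ) * (v (n + 1) - v n))
      (v (n + 1) - v n) ((n : ℝ) + 1 / 2) := by
    have h1 : HasDerivAt (fun t : ℝ => ((t - n : ℝ) : ℂ)) ((1 : ℝ) : ℂ) ((n : ℝ) + 1 / 2) :=
      ((hasDerivAt_id _).sub_const _).ofReal_comp
    simpa using (h1.mul_const (v (n + 1) - v n)).const_add (v n)
  refine h.congr_of_eventuallyEq ?_
  filter_upwards [Icc_mem_nhds (show (n : ℝ) < n + 1 / 2 by linarith)
    (show (n : ℝ) + 1 / 2 < n + 1 by linarith)] with t ht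
  exact polyline_eq v ht

theorem polyline_neg (v : ℤ → ℂ) (t : ℝ) : polyline v (-t) = polyline (fun n => v (-n)) t := by
  have h1 := Int.floor_le t
  have h2 := Int.lt_floor_add_one t
  rw [polyline_eq v (n := -⌊t⌋ - 1) (by push_cast; constructor <;> linarith), polyline]
  have e1 : -⌊t⌋ - 1 + 1 = -⌊t⌋ := by ring
  have e2 : -(⌊t⌋ + 1) = -⌊t⌋ - 1 := by ring
  rw [e1, e2]
  push_cast
  ring

theorem setOf_mapClusterPt_eq {α X : Type*} [TopologicalSpace X] [T3Space X] {K : Set X}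
    (hK : IsCompact K) {l : Filter α} {f : α → X} (hf : Tendsto f l (𝓝ˢ K))
    (h : ∀ y ∈ K, MapClusterPt y l f) : {w | MapClusterPt w l f} = K := by
  refine Set.Subset.antisymm (fun w hw => ?_) h
  by_contra hwK
  have hd : Disjoint (𝓝 w) (𝓝ˢ K) := disjoint_nhds_nhdsSet.2 (by rwa [hK.isClosed.closure_eq])
  exact hw.neBot.ne ((hd.mono_right hf).eq_bot)

theorem exists_polyline_end {K : Set (OnePoint ℂ)} (hKC : IsCompact K) (hK : IsConnected K)
    {d₁ d₂ u : ℂ} (hd₁ : d₁ ≠ 0) (hd₂ : d₂ ≠ 0) (hu : u ≠ 0) :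
    ∃ p : ℕ → ℂ, p 0 = 0 ∧ p 1 = u ∧
      (∀ n, cross (p (n + 1) - p n) (p (n + 2) - p (n + 1)) ≠ 0) ∧
      ∀ v : ℤ → ℂ, (∀ n : ℕ, v n = p n) →
        {w | MapClusterPt w atTop fun t => (polyline v t : OnePoint ℂ)} = K ∧
        ∀ d, d = d₁ ∨ d = d₂ → ∃ s : ℕ → ℝ, Tendsto s atTop atTop ∧
          (∀ k, ∃ r : ℝ, 0 < r ∧ HasDerivAt (polyline v) (r * d) (s k)) ∧
          {w | MapClusterPt w atTop fun k => (polyline v (s k) : OnePoint ℂ)} = K := by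
  obtain ⟨U, O, hU, hO, hOK, hrec⟩ := exists_antitone_nhds_and_recurrent_open_sets hKC hK.nonempty
  obtain ⟨p, τ, hp0, hp1, hp, hτ, hseg, hdir, hτO⟩ := exists_nodes hK.isPreconnected hU
    (O := fun k => O (k / 2)) (d := fun k => if Even k then d₁ else d₂) (fun k => hO _)
    (fun k => hOK _) (fun k => by split_ifs <;> assumption) hu
  refine ⟨p, hp0, hp1, hp, fun v hv => ?_⟩
  have hv' : ∀ n : ℕ, v ((n : ℤ) + 1) = p (n + 1) := fun n => by rw [← hv]; push_cast; rfl
  have htend : Tendsto (fun t => (polyline v t : OnePoint ℂ)) atTop (𝓝ˢ K) := by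
    refine tendsto_iff_eventually.2 fun N hN => ?_
    obtain ⟨m, hm⟩ := eventually_atTop.1 (hseg N hN)
    filter_upwards [eventually_ge_atTop (m : ℝ)] with t ht
    have hmt : (m : ℤ) ≤ ⌊t⌋ := Int.le_floor.2 (by exact_mod_cast ht)
    obtain ⟨n, hn⟩ := Int.eq_ofNat_of_zero_le (hmt.trans' (Int.natCast_nonneg m))
    have h := polyline_mem_segment v t
    rw [hn, hv, hv'] at h
    exact hm n (by omega) h
  have hs : ∀ (j : ℕ → ℕ) (d : ℂ), (∀ k, j k / 2 = k) →
      (∀ k, (if Even (j k) then d₁ else d₂) = d) →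
      ∃ s : ℕ → ℝ, Tendsto s atTop atTop ∧
        (∀ k, ∃ r : ℝ, 0 < r ∧ HasDerivAt (polyline v) (r * d) (s k)) ∧
        ∀ y ∈ K, MapClusterPt y atTop fun k => (polyline v (s k) : OnePoint ℂ) := by
    intro j d hj hjd
    have hjt : Tendsto j atTop atTop :=
      tendsto_atTop_mono (fun k => show k ≤ j k by have := hj k; omega) tendsto_id
    have hfl : ∀ k, ⌊((τ (j k) : ℤ) : ℝ) + 1 / 2⌋ = (τ (j k) : ℤ) := fun k =>
      Int.floor_eq_iff.2 ⟨by linarith, by linarith⟩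
    refine ⟨fun k => ((τ (j k) : ℤ) : ℝ) + 1 / 2, ?_, fun k => ?_, fun y hy => ?_⟩
    · simp only [Int.cast_natCast]
      exact tendsto_atTop_add_const_right _ _
        (tendsto_natCast_atTop_atTop.comp (hτ.comp hjt))
    · obtain ⟨r, hr, h⟩ := hdir (j k)
      rw [hjd] at h
      refine ⟨r, hr, ?_⟩
      rw [← h, ← hv', ← hv]
      exact hasDerivAt_polyline v _
    · refine mapClusterPt_iff_frequently.2 fun N hN => (hrec y hy N hN).mono fun k hk => hk ?_
      have h := polyline_mem_segment v (((τ (j k) : ℤ) : ℝ) + 1 / 2)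
      rw [hfl, hv, hv'] at h
      have h' := hτO (j k) h
      rwa [hj] at h'
  have hs₁ := hs (fun k => 2 * k) d₁ (fun k => by simp) fun k => by simp
  have hs₂ := hs (fun k => 2 * k + 1) d₂ (fun k => by omega) fun k => by
    rw [if_neg (by simp)]
  refine ⟨setOf_mapClusterPt_eq hKC htend fun y hy => ?_, fun d hd => ?_⟩
  · obtain ⟨s, hs, -, hcl⟩ := hs₁
    exact (hcl y hy).of_comp hs
  · rcases hd with rfl | rfl
    · obtain ⟨s, hs, hder, hcl⟩ := hs₁
      exact ⟨s, hs, hder, setOf_mapClusterPt_eq hKC (htend.comp hs) hcl⟩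
    · obtain ⟨s, hs, hder, hcl⟩ := hs₂
      exact ⟨s, hs, hder, setOf_mapClusterPt_eq hKC (htend.comp hs) hcl⟩

/-- A polygonal curve `η : ℝ → ℂ` (affine on each `[n, n+1]`, `n ∈ ℤ`) with prescribed
cluster sets `K⁻` at `-∞` and `K⁺` at `+∞`, no three consecutive nodes collinear, and,
towards each end, parameter sequences at which `η` has a horizontal (respectively vertical)
nonvanishing derivative and whose image sequences cluster exactly on the corresponding
continuum. -/
theorem polygonal_curve_with_prescribed_cluster_sets
    (Kneg Kpos : Set (OnePoint ℂ))
    (hKnegC : IsCompact Kneg) (hKnegConn : IsConnected Kneg)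
    (hKposC : IsCompact Kpos) (hKposConn : IsConnected Kpos) :
    ∃ η : ℝ → ℂ, Continuous η ∧
      -- affine on each interval [n, n+1]
      (∀ n : ℤ, ∀ t ∈ Set.Icc (n : ℝ) ((n : ℝ) + 1),
        η t = η n + ((t - n : ℝ) : ℂ) * (η ((n : ℝ) + 1) - η n)) ∧
      -- (i) no three consecutive nodes are collinear
      (∀ n : ℤ, ¬ Collinear ℝ
        ({η (n : ℝ), η ((n : ℝ) + 1), η ((n : ℝ) + 2)} : Set ℂ)) ∧
      -- (ii) cluster sets at the two ends
      ({w : OnePoint ℂ | MapClusterPt w atBot fun t : ℝ => ((η t : ℂ) : OnePoint ℂ)} = Kneg) ∧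
      ({w : OnePoint ℂ | MapClusterPt w atTop fun t : ℝ => ((η t : ℂ) : OnePoint ℂ)} = Kpos) ∧
      -- (iii) horizontal and vertical tangent sequences towards +∞, clustering exactly on K⁺
      (∃ s : ℕ → ℝ, Tendsto s atTop atTop ∧
        (∀ k, ∃ r : ℝ, 0 < r ∧ HasDerivAt η ((r : ℂ)) (s k)) ∧
        {w : OnePoint ℂ | MapClusterPt w atTop fun k : ℕ => ((η (s k) : ℂ) : OnePoint ℂ)}
          = Kpos) ∧
      (∃ s : ℕ → ℝ, Tendsto s atTop atTop ∧
        (∀ l, ∃ r : ℝ, 0 < r ∧ HasDerivAt η ((r : ℂ) * Complex.I) (s l)) ∧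
        {w : OnePoint ℂ | MapClusterPt w atTop fun l : ℕ => ((η (s l) : ℂ) : OnePoint ℂ)}
          = Kpos) ∧
      -- (iv) horizontal and vertical tangent sequences towards -∞, clustering exactly on K⁻
      (∃ s : ℕ → ℝ, Tendsto s atTop atBot ∧
        (∀ i, ∃ r : ℝ, 0 < r ∧ HasDerivAt η ((r : ℂ)) (s i)) ∧
        {w : OnePoint ℂ | MapClusterPt w atTop fun i : ℕ => ((η (s i) : ℂ) : OnePoint ℂ)}
          = Kneg) ∧
      (∃ s : ℕ → ℝ, Tendsto s atTop atBot ∧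
        (∀ j, ∃ r : ℝ, 0 < r ∧ HasDerivAt η ((r : ℂ) * Complex.I) (s j)) ∧
        {w : OnePoint ℂ | MapClusterPt w atTop fun j : ℕ => ((η (s j) : ℂ) : OnePoint ℂ)}
          = Kneg) := by
  obtain ⟨p, hp0, hp1, hp, hpv⟩ := exists_polyline_end hKposC hKposConn (d₁ := 1)
    (d₂ := Complex.I) (u := 1) one_ne_zero Complex.I_ne_zero one_ne_zero
  obtain ⟨q, hq0, hq1, hq, hqv⟩ := exists_polyline_end hKnegC hKnegConn (d₁ := -1)
    (d₂ := -Complex.I) (u := Complex.I) (neg_ne_zero.2 one_ne_zero)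
    (neg_ne_zero.2 Complex.I_ne_zero) Complex.I_ne_zero
  let v : ℤ → ℂ := fun n => if 0 ≤ n then p n.toNat else q (-n).toNat
  have hvp : ∀ n : ℕ, v n = p n := fun n => by simp [v]
  have hvq : ∀ n : ℕ, v (-n) = q n := by
    rintro (_ | n)
    · simp [v, hp0, hq0]
    · have h : ¬ (0 : ℤ) ≤ -((n + 1 : ℕ) : ℤ) := by omega
      simp only [v, if_neg h, neg_neg, Int.toNat_natCast]
  obtain ⟨hpos, hpos'⟩ := hpv v hvp
  obtain ⟨hneg, hneg'⟩ := hqv (fun n => v (-n)) hvq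
  have hcast : ∀ n : ℤ, polyline v ((n : ℝ) + 1) = v (n + 1) := fun n => by
    exact_mod_cast polyline_intCast v (n + 1)
  have hcast' : ∀ n : ℤ, polyline v ((n : ℝ) + 2) = v (n + 2) := fun n => by
    exact_mod_cast polyline_intCast v (n + 2)
  have hends : ∀ d, -d = -1 ∨ -d = -Complex.I → ∃ s : ℕ → ℝ, Tendsto s atTop atBot ∧
      (∀ k, ∃ r : ℝ, 0 < r ∧ HasDerivAt (polyline v) (r * d) (s k)) ∧
      {w | MapClusterPt w atTop fun k => (polyline v (s k) : OnePoint ℂ)} = Kneg := by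
    intro d hd
    obtain ⟨s, hs, hder, hcl⟩ := hneg' (-d) hd
    refine ⟨fun k => -s k, tendsto_neg_atTop_atBot.comp hs, fun k => ?_, ?_⟩
    · obtain ⟨r, hr, h⟩ := hder k
      refine ⟨r, hr, ?_⟩
      have h' := HasDerivAt.scomp (-s k) (by rwa [neg_neg]) (hasDerivAt_neg (-s k))
      refine (h'.congr_deriv (by simp)).congr_of_eventuallyEq (Eventually.of_forall fun t => ?_)
      simp [← polyline_neg]
    · simpa only [polyline_neg] using hcl
  refine ⟨polyline v, continuous_polyline v, fun n t ht => ?_, fun n => ?_, ?_, hpos, ?_, ?_, ?_, ?_⟩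
  · rw [polyline_intCast, hcast, polyline_eq v ht]
  · rw [polyline_intCast, hcast, hcast']
    rcases le_or_gt 0 n with hn | hn
    · obtain ⟨n, rfl⟩ := Int.eq_ofNat_of_zero_le hn
      have h := not_collinear_of_cross_ne_zero (hp n)
      rw [← hvp, ← hvp, ← hvp] at h
      exact_mod_cast h
    · obtain ⟨m, rfl⟩ : ∃ m : ℕ, n = -((m : ℤ) + 1) := ⟨(-n - 1).toNat, by omega⟩
      rcases m with _ | m
      · have e₁ : v (-((0 : ℕ) + 1 : ℤ)) = Complex.I := by rw [← hq1, ← hvq]; rfl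
        have e₂ : v (-((0 : ℕ) + 1 : ℤ) + 1) = 0 := by rw [← hp0, ← hvp]; rfl
        have e₃ : v (-((0 : ℕ) + 1 : ℤ) + 2) = 1 := by rw [← hp1, ← hvp]; rfl
        rw [e₁, e₂, e₃]
        exact not_collinear_of_cross_ne_zero (by simp [cross])
      · have h := not_collinear_of_cross_ne_zero (hq m)
        rw [← hvq, ← hvq, ← hvq] at h
        have e₁ : -(((m + 1 : ℕ) : ℤ) + 1) = -((m + 2 : ℕ) : ℤ) := by push_cast; ring
        have e₂ : -((m + 2 : ℕ) : ℤ) + 1 = -((m + 1 : ℕ) : ℤ) := by push_cast; ring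
        have e₃ : -((m + 2 : ℕ) : ℤ) + 2 = -(m : ℤ) := by push_cast; ring
        rw [e₁, e₂, e₃]
        convert h using 2
        ext z
        simp only [Set.mem_insert_iff, Set.mem_singleton_iff]
        tauto
  · rw [← hneg, ← map_neg_atTop]
    simp only [mapClusterPt_def, map_map, Function.comp_def, polyline_neg]
  · simpa only [mul_one] using hpos' 1 (Or.inl rfl)
  · exact hpos' Complex.I (Or.inr rfl)
  · simpa only [mul_one] using hends 1 (Or.inl rfl)
  · exact hends Complex.I (Or.inr rfl)
end

section
/- For any two continua K⁻ and K⁺ in the Riemann sphere, there exists a continuously differentiable (C¹) curve σ : ℝ → ℂ with deriv σ t ≠ 0 for all t ∈ ℝ, such that: (i) the cluster set of σ at −∞ equals K⁻ and the cluster set of σ at +∞ equals K⁺; (ii) there exist sequences of reals s(k) → +∞ and s(ℓ) → +∞ with deriv σ (s(k)) a positive real number for every k and deriv σ (s(ℓ)) a positive multiple of i for every ℓ, such that the cluster sets (in OnePoint ℂ) of the sequences k ↦ σ(s(k)) and ℓ ↦ σ(s(ℓ)) both equal K⁺; (iii) analogously there exist sequences tending to −∞ along which deriv σ is a positive real number,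 respectively a positive multiple of i, and whose image sequences both have cluster set exactly K⁻. -/
open Filter Topology

/-- Along a filter, two functions into `ℂ` at distance tending to `0` have the same limits in the
Riemann sphere. -/
lemma tendsto_onePoint_of_tendsto_sub_zero {ι : Type*} {l : Filter ι} {a b : ι → ℂ}
    (hab : Tendsto (fun i => b i - a i) l (𝓝 0)) {w : OnePoint ℂ}
    (ha : Tendsto (fun i => (a i : OnePoint ℂ)) l (𝓝 w)) :
    Tendsto (fun i => (b i : OnePoint ℂ)) l (𝓝 w) := by
  induction w using OnePoint.rec with
  | infty =>
    have key : ∀ c : ι → ℂ, Tendsto (fun i => (c i : OnePoint ℂ)) l (𝓝 (OnePoint.infty)) ↔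
        Tendsto (fun i => ‖c i‖) l atTop := fun c => by
      rw [tendsto_norm_atTop_iff_cobounded,
        Metric.cobounded_eq_cocompact, ← coclosedCompact_eq_cocompact,
        ← OnePoint.comap_coe_nhds_infty, tendsto_comap_iff]
      rfl
    rw [key] at ha ⊢
    have h1 : ∀ᶠ i in l, ‖a i‖ + -1 ≤ ‖b i‖ := by
      have h2 : ∀ᶠ i in l, ‖b i - a i‖ < 1 := by
        simpa using hab.norm.eventually (gt_mem_nhds (by simp : ‖(0:ℂ)‖ < 1))
      filter_upwards [h2] with i hi
      have := norm_sub_norm_le (a i) (b i)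
      rw [norm_sub_rev] at this
      linarith
    exact tendsto_atTop_mono' _ h1 (tendsto_atTop_add_const_right _ _ ha)
  | coe w =>
    have ha' : Tendsto a l (𝓝 w) := by
      rw [← OnePoint.comap_coe_nhds, tendsto_comap_iff]; exact ha
    have : Tendsto b l (𝓝 w) := by simpa using ha'.add hab
    exact (OnePoint.continuous_coe.tendsto w).comp this

lemma setOf_mapClusterPt_congr_of_tendsto_sub_zero {ι : Type*} {l : Filter ι} {a b : ι → ℂ}
    (hab : Tendsto (fun i => b i - a i) l (𝓝 0)) :
    {w : OnePoint ℂ | MapClusterPt w l fun i => (b i : OnePoint ℂ)} =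
      {w : OnePoint ℂ | MapClusterPt w l fun i => (a i : OnePoint ℂ)} := by
  have hba : Tendsto (fun i => a i - b i) l (𝓝 0) := by simpa using hab.neg
  ext w
  simp only [Set.mem_ofPred_eq, mapClusterPt_iff_ultrafilter]
  exact ⟨fun ⟨U, hU, h⟩ => ⟨U, hU, tendsto_onePoint_of_tendsto_sub_zero (hba.mono_left hU) h⟩,
    fun ⟨U, hU, h⟩ => ⟨U, hU, tendsto_onePoint_of_tendsto_sub_zero (hab.mono_left hU) h⟩⟩

/-- The `n`-th basic punctured neighbourhood, within `ℂ`, of a point of the Riemann sphere. -/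
def sphereNhd (n : ℕ) (x : OnePoint ℂ) : Set ℂ :=
  {z | (x = OnePoint.infty ∧ (n : ℝ) + 1 < ‖z‖) ∨ ∃ c : ℂ, x = c ∧ ‖z - c‖ < 1 / (2 * (n + 1))}

lemma sphereNhd_infty (n : ℕ) : sphereNhd n OnePoint.infty = {z | (n : ℝ) + 1 < ‖z‖} := by
  ext z; simp [sphereNhd]

lemma sphereNhd_coe (n : ℕ) (c : ℂ) :
    sphereNhd n c = {z | ‖z - c‖ < 1 / (2 * ((n : ℝ) + 1))} := by
  ext z; simp [sphereNhd]

lemma sphereNhd_antitone {m n : ℕ} (h : m ≤ n) (x : OnePoint ℂ) :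
    sphereNhd n x ⊆ sphereNhd m x := by
  have h' : (m : ℝ) ≤ n := by exact_mod_cast h
  intro z hz
  induction x using OnePoint.rec with
  | infty =>
    rw [sphereNhd_infty, Set.mem_ofPred_eq] at *
    linarith
  | coe c =>
    rw [sphereNhd_coe, Set.mem_ofPred_eq] at *
    exact hz.trans_le (by gcongr)

lemma sphereNhd_nonempty (n : ℕ) (x : OnePoint ℂ) : (sphereNhd n x).Nonempty := by
  induction x using OnePoint.rec with
  | infty =>
    rw [sphereNhd_infty]
    refine ⟨((n : ℝ) + 2 : ℝ), ?_⟩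
    rw [Set.mem_ofPred_eq, Complex.norm_real, Real.norm_eq_abs]
    linarith [le_abs_self ((n : ℝ) + 2)]
  | coe c =>
    rw [sphereNhd_coe]
    refine ⟨c, ?_⟩
    simp only [Set.mem_ofPred_eq, sub_self, norm_zero]
    positivity

lemma eventually_sphereNhd_inter_nonempty (n : ℕ) (x : OnePoint ℂ) :
    ∀ᶠ y in 𝓝 x, (sphereNhd n x ∩ sphereNhd n y).Nonempty := by
  have self : ∀ c : ℂ, c ∈ sphereNhd n c := fun c => by
    simp only [sphereNhd_coe, Set.mem_ofPred_eq, sub_self, norm_zero]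
    positivity
  induction x using OnePoint.rec with
  | infty =>
    rw [OnePoint.nhds_infty_eq, eventually_sup, eventually_pure, eventually_map]
    refine ⟨?_, by simpa using sphereNhd_nonempty n _⟩
    rw [coclosedCompact_eq_cocompact]
    filter_upwards [(tendsto_norm_cocompact_atTop (E := ℂ)).eventually_gt_atTop ((n : ℝ) + 1)]
      with c hc
    exact ⟨c, by rwa [sphereNhd_infty], self c⟩
  | coe x =>
    rw [OnePoint.nhds_coe_eq, eventually_map]
    filter_upwards [Metric.ball_mem_nhds x (show 0 < 1 / (2 * ((n : ℝ) + 1)) by positivity)]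
      with c hc
    exact ⟨c, by rw [sphereNhd_coe]; simpa [dist_eq_norm] using hc, self c⟩

/-- If `z i` lies in ever smaller basic neighbourhoods of `x i`, then `z` and `x` have the same
limits along ultrafilters. -/
lemma tendsto_of_mem_sphereNhd {ι : Type*} {l : Ultrafilter ι} {n : ι → ℕ}
    (hn : Tendsto n l atTop) {z : ι → ℂ} {x : ι → OnePoint ℂ}
    (hz : ∀ i, z i ∈ sphereNhd (n i) (x i)) {w : OnePoint ℂ} (hx : Tendsto x l (𝓝 w)) :
    Tendsto (fun i => (z i : OnePoint ℂ)) l (𝓝 w) := by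
  have hn' : Tendsto (fun i => (n i : ℝ) + 1) l atTop :=
    tendsto_atTop_add_const_right _ _ (tendsto_natCast_atTop_atTop.comp hn)
  rcases l.em (fun i => x i = OnePoint.infty) with h | h
  · have hw : w = OnePoint.infty :=
      tendsto_nhds_unique hx (tendsto_const_nhds.congr' (h.mono fun i hi => hi.symm))
    subst hw
    have h1 : Tendsto (fun i => ‖z i‖) l atTop := by
      refine tendsto_atTop_mono' _ (h.mono fun i hi => ?_) hn'
      have := hz i
      rw [hi, sphereNhd_infty] at this
      exact this.le
    rw [tendsto_norm_atTop_iff_cobounded, Metric.cobounded_eq_cocompact,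
      ← coclosedCompact_eq_cocompact] at h1
    exact OnePoint.tendsto_coe_infty.comp h1
  · have hc : ∀ i, ∃ c : ℂ, x i ≠ OnePoint.infty → x i = c := fun i => by
      induction x i using OnePoint.rec with
      | infty => exact ⟨0, by simp⟩
      | coe c => exact ⟨c, fun _ => rfl⟩
    choose c hc using hc
    have h1 : Tendsto (fun i => z i - c i) l (𝓝 0) := by
      refine squeeze_zero_norm' (a := fun i => ((n i : ℝ) + 1)⁻¹) (h.mono fun i hi => ?_)
        hn'.inv_tendsto_atTop
      have := hz i
      rw [hc i hi, sphereNhd_coe, Set.mem_ofPred_eq] at this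
      refine this.le.trans ?_
      rw [← one_div]
      have : (0 : ℝ) ≤ n i := by positivity
      gcongr
      linarith
    refine tendsto_onePoint_of_tendsto_sub_zero h1 (hx.congr' (h.mono fun i hi => hc i hi))

/-- One step of length at most `δ` between points of a set `s`. -/
def ShortStep (s : Set ℂ) (δ : ℝ) (a b : ℂ) : Prop := a ∈ s ∧ b ∈ s ∧ ‖b - a‖ ≤ δ

lemma ShortStep.symm {s : Set ℂ} {δ : ℝ} {a b : ℂ} (h : ShortStep s δ a b) :
    ShortStep s δ b a := ⟨h.2.1, h.1, by rw [norm_sub_rev]; exact h.2.2⟩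

lemma reflTransGen_shortStep_symm {s : Set ℂ} {δ : ℝ} {a b : ℂ}
    (h : Relation.ReflTransGen (ShortStep s δ) a b) :
    Relation.ReflTransGen (ShortStep s δ) b a := by
  induction h with
  | refl => exact .refl
  | tail _ h ih => exact .head h.symm ih

lemma IsPreconnected.reflTransGen_shortStep {s : Set ℂ} (hs : IsPreconnected s) {δ : ℝ}
    (hδ : 0 < δ) {a b : ℂ} (ha : a ∈ s) (hb : b ∈ s) :
    Relation.ReflTransGen (ShortStep s δ) a b := by
  refine hs.induction₂ (Relation.ReflTransGen (ShortStep s δ)) (fun x hx => ?_)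
    (fun _ _ _ _ _ _ => .trans)
    (fun _ _ _ _ => reflTransGen_shortStep_symm) ha hb
  filter_upwards [self_mem_nhdsWithin, mem_nhdsWithin_of_mem_nhds (Metric.ball_mem_nhds x hδ)]
    with y hy hxy
  rw [Metric.mem_ball, dist_eq_norm] at hxy
  exact .single ⟨hx, hy, hxy.le⟩

lemma isPreconnected_setOf_lt_norm {r : ℝ} (hr : 0 < r) : IsPreconnected {z : ℂ | r < ‖z‖} := by
  have h : {z : ℂ | r < ‖z‖} = Complex.exp '' {z | Real.log r < z.re} := by
    ext z
    constructor
    · intro hz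
      have hz' : r < ‖z‖ := hz
      have h0 : z ≠ 0 := norm_pos_iff.1 (hr.trans hz')
      refine ⟨Complex.log z, ?_, Complex.exp_log h0⟩
      rw [Set.mem_ofPred_eq, Complex.log_re]
      exact Real.log_lt_log hr hz'
    · rintro ⟨y, hy, rfl⟩
      rw [Set.mem_ofPred_eq, Complex.norm_exp]
      exact (Real.log_lt_iff_lt_exp hr).1 hy
  rw [h]
  exact (convex_halfSpace_re_gt _).isPreconnected.image _ Complex.continuous_exp.continuousOn

lemma reflTransGen_shortStep_sphereNhd (n : ℕ) (x : OnePoint ℂ) {a b : ℂ}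
    (ha : a ∈ sphereNhd n x) (hb : b ∈ sphereNhd n x) :
    Relation.ReflTransGen (ShortStep (sphereNhd n x) (1 / (n + 1))) a b := by
  induction x using OnePoint.rec with
  | infty =>
    rw [sphereNhd_infty] at *
    exact (isPreconnected_setOf_lt_norm (by positivity)).reflTransGen_shortStep
      (by positivity) ha hb
  | coe c =>
    rw [sphereNhd_coe] at *
    refine .single ⟨ha, hb, ?_⟩
    have h1 := norm_sub_le (b - c) (a - c)
    rw [sub_sub_sub_cancel_right] at h1
    have h2 : 1 / (2 * ((n : ℝ) + 1)) + 1 / (2 * (n + 1)) = 1 / (n + 1) := by field_simp; norm_num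
    rw [Set.mem_ofPred_eq] at ha hb
    linarith

/-- Points near a connected subset of the sphere are joined by chains with short steps. -/
lemma IsPreconnected.reflTransGen_shortStep_iUnion_sphereNhd {K : Set (OnePoint ℂ)}
    (hK : IsPreconnected K) (n : ℕ) {x y : OnePoint ℂ} (hx : x ∈ K) (hy : y ∈ K) {a b : ℂ}
    (ha : a ∈ sphereNhd n x) (hb : b ∈ sphereNhd n y) :
    Relation.ReflTransGen (ShortStep (⋃ x ∈ K, sphereNhd n x) (1 / (n + 1))) a b := by
  have loc : ∀ x ∈ K, ∀ a ∈ sphereNhd n x, ∀ b ∈ sphereNhd n x,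
      Relation.ReflTransGen (ShortStep (⋃ x ∈ K, sphereNhd n x) (1 / (n + 1))) a b := by
    intro x hx a ha b hb
    have hsub : sphereNhd n x ⊆ ⋃ x ∈ K, sphereNhd n x := Set.subset_biUnion_of_mem hx
    refine Relation.ReflTransGen.mono ?_ _ _ (reflTransGen_shortStep_sphereNhd n x ha hb)
    exact fun _ _ h => ⟨hsub h.1, hsub h.2.1, h.2.2⟩
  refine hK.induction₂ (fun x y => ∀ a ∈ sphereNhd n x, ∀ b ∈ sphereNhd n y,
      Relation.ReflTransGen (ShortStep (⋃ x ∈ K, sphereNhd n x) (1 / (n + 1))) a b)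
    (fun x hx => ?_) (fun x y z hx hy hz hxy hyz a ha b hb => ?_)
    (fun x y _ _ h a ha b hb => reflTransGen_shortStep_symm (h b hb a ha)) hx hy a ha b hb
  · filter_upwards [self_mem_nhdsWithin,
      mem_nhdsWithin_of_mem_nhds (eventually_sphereNhd_inter_nonempty n x)]
      with y hy ⟨c, hcx, hcy⟩ a ha b hb
    exact (loc x hx a ha c hcx).trans (loc y hy c hcy b hb)
  · obtain ⟨c, hc⟩ := sphereNhd_nonempty n y
    exact (hxy a ha c hc).trans (hyz c hc b hb)

lemma Relation.ReflTransGen.exists_chain {α : Type*} {R : α → α → Prop} {a b : α}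
    (h : Relation.ReflTransGen R a b) :
    ∃ (L : ℕ) (c : ℕ → α), c 0 = a ∧ c L = b ∧ ∀ i < L, R (c i) (c (i + 1)) := by
  induction h using Relation.ReflTransGen.head_induction_on with
  | refl => exact ⟨0, fun _ => b, rfl, rfl, by simp⟩
  | @head a a' haa' _ ih =>
    obtain ⟨L, c, h0, hL, hc⟩ := ih
    refine ⟨L + 1, fun i => Nat.casesOn i a c, rfl, hL, fun i hi => ?_⟩
    cases i with
    | zero => simpa [h0] using haa'
    | succ i => exact hc i (by omega)

/-- Concatenation of infinitely many finite chains. -/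
lemma exists_concat_chain {α : Type*} {R : ℕ → α → α → Prop} {y : ℕ → α}
    (hrefl : ∀ n, R n (y (n + 1)) (y (n + 1)))
    (hy : ∀ n, Relation.ReflTransGen (R n) (y n) (y (n + 1))) :
    ∃ (z : ℕ → α) (n m : ℕ → ℕ), Tendsto n atTop atTop ∧ Tendsto m atTop atTop ∧
      (∀ k, R (n k) (z k) (z (k + 1))) ∧ ∀ j, z (m j) = y j := by
  choose L c h0 hL hc using fun n => (hy n).exists_chain
  let next : ℕ × ℕ → ℕ × ℕ := fun p => if p.2 < L p.1 then (p.1, p.2 + 1) else (p.1 + 1, 0)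
  let s : ℕ → ℕ × ℕ := fun k => next^[k] (0, 0)
  have hs : ∀ k, s (k + 1) = next (s k) := fun k => Function.iterate_succ_apply' _ _ _
  have inv : ∀ k, (s k).2 ≤ L (s k).1 := by
    intro k
    induction k with
    | zero => exact Nat.zero_le _
    | succ k ih =>
      rw [hs]
      by_cases h : (s k).2 < L (s k).1
      · simp only [next, h, if_true]; omega
      · simp only [next, h, if_false]; omega
  have mono : Monotone fun k => (s k).1 := by
    refine monotone_nat_of_le_succ fun k => ?_
    rw [hs]
    by_cases h : (s k).2 < L (s k).1
    · simp only [next, h, if_true]; omega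
    · simp only [next, h, if_false]; omega
  have bound : ∀ k, (s k).1 ≤ k := by
    intro k
    induction k with
    | zero => exact Nat.le_refl _
    | succ k ih =>
      rw [hs]
      by_cases h : (s k).2 < L (s k).1
      · simp only [next, h, if_true]; omega
      · simp only [next, h, if_false]; omega
  have reach : ∀ j, ∃ k, s k = (j, 0) := by
    intro j
    induction j with
    | zero => exact ⟨0, rfl⟩
    | succ j ih =>
      obtain ⟨k, hk⟩ := ih
      have : ∀ i ≤ L j, s (k + i) = (j, i) := by
        intro i
        induction i with
        | zero => intro _; exact hk
        | succ i ih =>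
          intro hi
          rw [← add_assoc, hs, ih (by omega)]
          simp only [next]
          rw [if_pos (by omega)]
      refine ⟨k + L j + 1, ?_⟩
      rw [hs, this _ le_rfl]
      simp [next]
  choose m hm using reach
  refine ⟨fun k => c (s k).1 (s k).2, fun k => (s k).1, m, ?_, ?_, fun k => ?_, fun j => ?_⟩
  · exact tendsto_atTop_atTop_of_monotone mono fun j => ⟨m j, by simp [hm]⟩
  · refine tendsto_atTop_mono (fun j => ?_) tendsto_id
    have := bound (m j)
    rw [hm] at this
    exact this
  · beta_reduce
    rw [hs]
    by_cases h : (s k).2 < L (s k).1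
    · simp only [next, h, if_true]
      exact hc _ _ h
    · have h' : (s k).2 = L (s k).1 := le_antisymm (inv k) (not_lt.1 h)
      simp only [next, h, if_false]
      rw [h', hL, h0]
      exact hrefl _
  · simp [hm, h0]

lemma exists_countable_subset_closure (K : Set (OnePoint ℂ)) :
    ∃ C ⊆ K, C.Countable ∧ K ⊆ closure C := by
  obtain ⟨C, hCK, hC, hKC⟩ :=
    (TopologicalSpace.IsSeparable.of_separableSpace
      ((↑) ⁻¹' K : Set ℂ)).exists_countable_dense_subset
  refine ⟨(↑) '' C ∪ (K ∩ {OnePoint.infty}), ?_, ?_, ?_⟩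
  · rintro _ (⟨c, hc, rfl⟩ | h)
    · exact hCK hc
    · exact h.1
  · exact (hC.image _).union ((Set.countable_singleton _).mono Set.inter_subset_right)
  · intro x hx
    induction x using OnePoint.rec with
    | infty => exact subset_closure (Or.inr ⟨hx, rfl⟩)
    | coe c =>
      refine closure_mono Set.subset_union_left ?_
      exact image_closure_subset_closure_image OnePoint.continuous_coe ⟨c, hKC hx, rfl⟩

/-- Every continuum in the sphere is the cluster set of a sequence in `ℂ` with steps tending
to zero. -/
lemma exists_seq_setOf_mapClusterPt_eq {K : Set (OnePoint ℂ)} (hKc : IsCompact K)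
    (hK : IsConnected K) :
    ∃ z : ℕ → ℂ, Tendsto (fun k => z (k + 1) - z k) atTop (𝓝 0) ∧
      {w : OnePoint ℂ | MapClusterPt w atTop fun k => (z k : OnePoint ℂ)} = K := by
  obtain ⟨C, hCK, hC, hKC⟩ := exists_countable_subset_closure K
  have hCne : C.Nonempty := closure_nonempty_iff.1 (hK.nonempty.mono hKC)
  obtain ⟨e, rfl⟩ := hC.exists_eq_range hCne
  let x : ℕ → OnePoint ℂ := fun n => e n.unpair.1
  have hx : ∀ n, x n ∈ K := fun n => hCK ⟨_, rfl⟩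
  choose y hy using fun n => sphereNhd_nonempty n (x n)
  let R : ℕ → ℂ → ℂ → Prop := fun n => ShortStep (⋃ x ∈ K, sphereNhd n x) (1 / (n + 1))
  have hy' : ∀ n, y (n + 1) ∈ sphereNhd n (x (n + 1)) := fun n =>
    sphereNhd_antitone (Nat.le_succ n) _ (hy (n + 1))
  have hRrefl : ∀ n, R n (y (n + 1)) (y (n + 1)) := fun n => by
    have := Set.mem_biUnion (hx (n + 1)) (hy' n)
    exact ⟨this, this, by rw [sub_self, norm_zero]; positivity⟩
  obtain ⟨z, n, m, hn, hm, hz, hzy⟩ := exists_concat_chain hRrefl fun n =>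
    hK.isPreconnected.reflTransGen_shortStep_iUnion_sphereNhd n (hx n) (hx (n + 1)) (hy n) (hy' n)
  refine ⟨z, ?_, Set.Subset.antisymm (fun w hw => ?_) ?_⟩
  · exact squeeze_zero_norm (fun k => (hz k).2.2) (tendsto_one_div_add_atTop_nhds_zero_nat.comp hn)
  · obtain ⟨U, hU, hw⟩ := mapClusterPt_iff_ultrafilter.1 hw
    have hzn : ∀ k, ∃ x ∈ K, z k ∈ sphereNhd (n k) x := fun k => by simpa using (hz k).1
    choose v hvK hzv using hzn
    obtain ⟨v₀, hv₀, hv⟩ := hKc.ultrafilter_le_nhds (U.map v)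
      (le_principal_iff.2 (Filter.mem_map.2 (Eventually.of_forall hvK)))
    have := tendsto_of_mem_sphereNhd (hn.mono_left hU) hzv hv
    rwa [tendsto_nhds_unique hw this]
  · refine hKC.trans (closure_minimal ?_ isClosed_setOfPred_clusterPt)
    rintro _ ⟨i, rfl⟩
    change MapClusterPt (e i) atTop fun k => (z k : OnePoint ℂ)
    have hp : Tendsto (fun j => Nat.pair i j) atTop atTop :=
      tendsto_atTop_mono (fun j => Nat.right_le_pair i j) tendsto_id
    refine MapClusterPt.of_comp (hm.comp hp) ?_
    rw [mapClusterPt_iff_ultrafilter]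
    refine ⟨Ultrafilter.of atTop, Ultrafilter.of_le _, ?_⟩
    have hx' : ∀ j, x (Nat.pair i j) = e i := fun j => by simp [x]
    refine tendsto_of_mem_sphereNhd (n := fun j => Nat.pair i j) (x := fun _ => e i)
      (hp.mono_left (Ultrafilter.of_le _)) (fun j => ?_) tendsto_const_nhds
    have := hy (Nat.pair i j)
    rw [hx'] at this
    simpa [hzy] using this

/-- A `C¹` curve through prescribed points at the integers. -/
lemma exists_contDiff_interpolation (z : ℤ → ℂ) :
    ∃ γ f : ℝ → ℂ, Continuous f ∧ (∀ t, HasDerivAt γ (f t) t) ∧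
      (∀ (j : ℤ) (t : ℝ), t ∈ Set.Icc (j : ℝ) (j + 1) → ‖f t‖ ≤ 2 * ‖z (j + 1) - z j‖) ∧
      ∀ j : ℤ, γ j = z j := by
  let w : ℤ → ℂ := fun j => z (j + 1) - z j
  let b : ℝ → ℝ := fun t => 1 - Real.cos (t * (2 * Real.pi))
  let f : ℝ → ℂ := fun t => (b t : ℂ) * w ⌊t⌋
  have hb : Continuous b := by fun_prop
  have hbint : ∀ j : ℤ, b j = 0 := fun j => by simp [b, Real.cos_int_mul_two_pi]
  have hf : ∀ (j : ℤ) (t : ℝ), t ∈ Set.Icc (j : ℝ) (j + 1) → f t = (b t : ℂ) * w j := by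
    intro j t ht
    rcases ht.2.lt_or_eq with h | h
    · have : ⌊t⌋ = j := Int.floor_eq_iff.2 ⟨ht.1, h⟩
      simp only [f, this]
    · have : b t = 0 := by
        rw [h]; exact_mod_cast hbint (j + 1)
      simp [f, this]
  have hfc : Continuous f := by
    have hlf : LocallyFinite fun j : ℤ => Set.Icc (j : ℝ) (j + 1) :=
      locallyFinite_Icc_of_tendsto tendsto_intCast_atTop_atTop
        (tendsto_atBot_add_const_right _ _ (tendsto_intCast_atBot_iff.2 tendsto_id))
    refine hlf.continuous (Set.eq_univ_of_forall fun t => ?_) (fun j => isClosed_Icc) fun j => ?_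
    · exact Set.mem_iUnion.2 ⟨⌊t⌋, Int.floor_le t, (Int.lt_floor_add_one t).le⟩
    · exact ContinuousOn.congr (by fun_prop) (hf j)
  have hint : ∀ j : ℤ, ∫ t in (j : ℝ)..(j + 1), f t = w j := by
    intro j
    have h1 : ∫ t in (j : ℝ)..(j + 1), f t = ∫ t in (j : ℝ)..(j + 1), (b t : ℂ) * w j :=
      intervalIntegral.integral_congr fun t ht => hf j t (by rwa [Set.uIcc_of_le (by simp)] at ht)
    have h2 : ∫ t in (j : ℝ)..(j + 1), b t = 1 := by
      have h3 : Real.sin ((j + 1) * (2 * Real.pi)) = 0 := by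
        have := Real.sin_int_mul_pi ((j + 1) * 2)
        push_cast at this
        rwa [mul_assoc] at this
      have h4 : Real.sin (j * (2 * Real.pi)) = 0 := by
        have := Real.sin_int_mul_pi (j * 2)
        push_cast at this
        rwa [mul_assoc] at this
      have h5 : ∀ t ∈ Set.uIcc (j : ℝ) (j + 1), HasDerivAt
          (fun t => t - Real.sin (t * (2 * Real.pi)) / (2 * Real.pi)) (b t) t := by
        intro t _
        have := ((hasDerivAt_id t).sub
          ((((hasDerivAt_id t).mul_const (2 * Real.pi)).sin).div_const (2 * Real.pi)))
        convert! this using 1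
        have := Real.pi_ne_zero
        simp only [b, id]
        field_simp
      rw [intervalIntegral.integral_eq_sub_of_hasDerivAt h5 (hb.intervalIntegrable _ _), h3, h4]
      simp
    rw [h1, intervalIntegral.integral_mul_const, intervalIntegral.integral_ofReal, h2]
    simp
  have hii : ∀ u v : ℝ, IntervalIntegrable f MeasureTheory.volume u v := fun u v =>
    hfc.intervalIntegrable u v
  let γ : ℝ → ℂ := fun t => z 0 + ∫ u in (0 : ℝ)..t, f u
  have hstep : ∀ j : ℤ, γ ((j + 1 : ℤ) : ℝ) = γ j + w j := by
    intro j
    simp only [γ]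
    rw [← intervalIntegral.integral_add_adjacent_intervals (hii 0 j) (hii j _)]
    push_cast
    rw [hint, add_assoc]
  refine ⟨γ, f, hfc, fun t => ?_, fun j t ht => ?_, fun j => ?_⟩
  · exact (intervalIntegral.integral_hasDerivAt_right (hii 0 t)
      (hfc.stronglyMeasurableAtFilter _ _) hfc.continuousAt).const_add _
  · rw [hf j t ht, norm_mul, Complex.norm_real, Real.norm_eq_abs]
    gcongr
    simp only [b]
    rw [abs_le]
    constructor <;> linarith [Real.neg_one_le_cos (t * (2 * Real.pi)),
      Real.cos_le_one (t * (2 * Real.pi))]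
  · induction j using Int.induction_on with
    | zero => simp [γ]
    | succ i ih =>
      rw [hstep, ih]; simp [w]
    | pred i ih =>
      have := hstep (-i - 1)
      rw [sub_add_cancel, ih] at this
      simp only [w, sub_add_cancel] at this
      linear_combination -this

/-- A continuous function without zeros whose argument is `θ` up to an error of less than `π / 2`
attains every direction on an interval on which `θ` grows by `3 π`. -/
lemma exists_eq_mul_exp_of_turn {θ : ℝ → ℝ} {η : ℝ → ℂ} (hθ : Continuous θ) (hη : Continuous η)
    (hη1 : ∀ t, ‖η t‖ < 1) {a b : ℝ} (hab : a ≤ b) (hturn : θ a + 3 * Real.pi ≤ θ b) (α : ℝ) :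
    ∃ s ∈ Set.Icc a b, ∃ r : ℝ, 0 < r ∧
      Complex.exp (θ s * Complex.I) * (1 + η s) = r * Complex.exp (α * Complex.I) := by
  have hre : ∀ t, 0 < (1 + η t).re := fun t => by
    have := (abs_lt.1 ((Complex.abs_re_le_norm (η t)).trans_lt (hη1 t))).1
    simp only [Complex.add_re, Complex.one_re]
    linarith
  let φ : ℝ → ℝ := fun t => θ t + (1 + η t).arg
  have hφ : Continuous φ := hθ.add <| continuous_iff_continuousAt.2 fun t =>
    ContinuousAt.comp (f := fun t => 1 + η t) (Complex.continuousAt_arg (Or.inl (hre t)))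
      (by fun_prop)
  have harg : ∀ t, |(1 + η t).arg| < Real.pi / 2 := fun t =>
    Complex.abs_arg_lt_pi_div_two_iff.2 (Or.inl (hre t))
  have hpi := Real.pi_pos
  let m : ℤ := ⌈(φ a - α) / (2 * Real.pi)⌉
  have hm1 : φ a ≤ α + m * (2 * Real.pi) := by
    have := Int.le_ceil ((φ a - α) / (2 * Real.pi))
    rw [div_le_iff₀ (by positivity)] at this
    linarith
  have hm2 : α + m * (2 * Real.pi) ≤ φ b := by
    have := Int.ceil_lt_add_one ((φ a - α) / (2 * Real.pi))
    rw [← sub_lt_iff_lt_add, lt_div_iff₀ (by positivity)] at this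
    have h1 := (abs_lt.1 (harg a)).2
    have h2 := (abs_lt.1 (harg b)).1
    simp only [φ, m] at *
    linarith
  obtain ⟨s, hs, hφs⟩ := intermediate_value_Icc hab hφ.continuousOn ⟨hm1, hm2⟩
  refine ⟨s, hs, ‖1 + η s‖, norm_pos_iff.2 fun h => (hre s).ne' (by rw [h]; rfl), ?_⟩
  have h1 : Complex.exp (φ s * Complex.I) = Complex.exp (α * Complex.I) := by
    rw [hφs]
    push_cast
    rw [add_mul, mul_assoc, Complex.exp_add, Complex.exp_int_mul_two_pi_mul_I, mul_one]
  rw [← h1]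
  conv_lhs => rw [← Complex.norm_mul_exp_arg_mul_I (1 + η s)]
  simp only [φ]
  push_cast
  rw [add_mul, Complex.exp_add]
  ring

/-- A regular `C¹` curve following a given sequence of points, and taking every tangent direction
between any two consecutive points. -/
lemma exists_regular_curve (z : ℤ → ℂ) {B : ℝ} (hB : ∀ j, ‖z (j + 1) - z j‖ ≤ B) :
    ∃ σ : ℝ → ℂ, ContDiff ℝ 1 σ ∧ (∀ t, deriv σ t ≠ 0) ∧
      (∀ (j : ℤ) (t : ℝ), t ∈ Set.Icc (j : ℝ) (j + 1) →
        ‖σ t - z j‖ ≤ 2 * ‖z (j + 1) - z j‖ + 1 / (t ^ 2 + 4)) ∧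
      ∀ (α : ℝ) (j : ℤ), ∃ s ∈ Set.Icc (j : ℝ) (j + 1), ∃ r : ℝ, 0 < r ∧
        deriv σ s = r * Complex.exp (α * Complex.I) := by
  obtain ⟨γ, f, hfc, hγ, hf, hγz⟩ := exists_contDiff_interpolation z
  have hB0 : 0 ≤ B := (norm_nonneg _).trans (hB 0)
  have hfB : ∀ t, ‖f t‖ ≤ 2 * B := fun t =>
    (hf ⌊t⌋ t ⟨Int.floor_le t, (Int.lt_floor_add_one t).le⟩).trans (by linarith [hB ⌊t⌋])
  obtain ⟨A, hA⟩ : ∃ A, A = 2 * B + 3 := ⟨_, rfl⟩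
  have hA0 : (A : ℂ) ≠ 0 := by
    rw [Complex.ofReal_ne_zero]; linarith
  let θ : ℝ → ℝ := fun t => A * (t ^ 3 / 3 + 4 * t)
  let E : ℝ → ℂ := fun t => Complex.exp (θ t * Complex.I)
  let ε : ℝ → ℝ := fun t => 1 / (t ^ 2 + 4)
  let ε' : ℝ → ℝ := fun t => -(2 * t) / (t ^ 2 + 4) ^ 2
  have hpos : ∀ t : ℝ, 0 < t ^ 2 + 4 := fun t => by positivity
  have hθ : ∀ t, HasDerivAt θ (A * (t ^ 2 + 4)) t := fun t => by
    have := ((((hasDerivAt_id t).pow 3).div_const 3).add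
      ((hasDerivAt_id t).const_mul 4)).const_mul A
    convert! this using 1
    simp only [id]; ring
  have hθc : Continuous θ := by fun_prop
  have hEc : Continuous E := by fun_prop
  have hε : ∀ t, HasDerivAt ε (ε' t) t := fun t => by
    have := (((hasDerivAt_id t).pow 2).add_const 4).inv (hpos t).ne'
    simp only [ε, one_div]
    convert! this using 1
    simp [ε']
  have hε'c : Continuous ε' :=
    Continuous.div (by fun_prop) (by fun_prop) fun t => (pow_pos (hpos t) 2).ne'
  have hε' : ∀ t, |ε' t| ≤ 1 := fun t => by
    rw [abs_div, abs_neg, abs_of_pos (pow_pos (hpos t) 2), div_le_one (pow_pos (hpos t) 2), abs_le]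
    constructor <;> nlinarith [sq_nonneg (t - 1), sq_nonneg (t + 1), sq_nonneg (t ^ 2)]
  have hE1 : ∀ t, ‖E t‖ = 1 := fun t => Complex.norm_exp_ofReal_mul_I _
  have hE : ∀ t, HasDerivAt E (E t * ((A * (t ^ 2 + 4) : ℝ) * Complex.I)) t := fun t =>
    (((hθ t).ofReal_comp).mul_const Complex.I).cexp
  let g : ℝ → ℂ := fun t => f t + ((ε' t : ℂ) * E t + E t * (A * Complex.I))
  have hg : Continuous g := by fun_prop
  let σ : ℝ → ℂ := fun t => γ t + (ε t : ℂ) * E t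
  have hσ : ∀ t, HasDerivAt σ (g t) t := fun t => by
    have := (hγ t).add (((hε t).ofReal_comp).mul (hE t))
    convert! this using 1
    have h : ((t : ℂ) ^ 2 + 4) ≠ 0 := by exact_mod_cast (hpos t).ne'
    simp only [g, ε]
    push_cast
    field_simp
  have hderiv : deriv σ = g := funext fun t => (hσ t).deriv
  let η : ℝ → ℂ := fun t => (f t * (E t)⁻¹ + ε' t) * (A * Complex.I)⁻¹
  have hηc : Continuous η := by
    have : Continuous fun t => (E t)⁻¹ := hEc.inv₀ fun t => Complex.exp_ne_zero _
    fun_prop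
  have hη : ∀ t, ‖η t‖ < 1 := fun t => by
    simp only [η]
    rw [norm_mul, norm_inv, norm_mul, Complex.norm_I, mul_one, Complex.norm_real, Real.norm_eq_abs,
      abs_of_pos (by linarith : 0 < A), ← div_eq_mul_inv, div_lt_one (by linarith)]
    refine (norm_add_le _ _).trans_lt ?_
    rw [norm_mul, norm_inv, hE1, Complex.norm_real, Real.norm_eq_abs]
    linarith [hε' t, hfB t]
  have hgη : ∀ t, g t = A * (Complex.exp ((θ t + Real.pi / 2 : ℝ) * Complex.I) * (1 + η t)) :=
    fun t => by
      have hEt : E t ≠ 0 := Complex.exp_ne_zero _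
      push_cast
      rw [add_mul, Complex.exp_add, Complex.exp_pi_div_two_mul_I]
      change g t = A * (E t * Complex.I * (1 + η t))
      simp only [g, η]
      field_simp [Complex.I_ne_zero]
      ring
  refine ⟨σ, ?_, fun t => ?_, fun j t ht => ?_, fun α j => ?_⟩
  · exact contDiff_one_iff_deriv.2 ⟨fun t => (hσ t).differentiableAt, hderiv ▸ hg⟩
  · rw [hderiv, hgη]
    refine mul_ne_zero hA0 (mul_ne_zero (Complex.exp_ne_zero _) fun h => ?_)
    have := hη t
    rw [← neg_eq_of_add_eq_zero_right h, norm_neg, norm_one] at this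
    exact lt_irrefl _ this
  · have h1 : ‖γ t - γ j‖ ≤ 2 * ‖z (j + 1) - z j‖ * (t - j) :=
      norm_image_sub_le_of_norm_deriv_le_segment' (b := (j : ℝ) + 1)
        (fun x _ => (hγ x).hasDerivWithinAt) (fun x hx => hf j x ⟨hx.1, hx.2.le⟩) t ht
    have h2 : 2 * ‖z (j + 1) - z j‖ * (t - j) ≤ 2 * ‖z (j + 1) - z j‖ :=
      mul_le_of_le_one_right (by positivity) (by linarith [ht.2])
    have h3 : ‖(ε t : ℂ) * E t‖ = 1 / (t ^ 2 + 4) := by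
      rw [norm_mul, hE1, mul_one, Complex.norm_real, Real.norm_eq_abs,
        abs_of_pos (one_div_pos.2 (hpos t))]
    calc ‖σ t - z j‖ = ‖(γ t - γ j) + ε t * E t‖ := by rw [hγz]; congr 1; simp only [σ]; ring
      _ ≤ ‖γ t - γ j‖ + ‖(ε t : ℂ) * E t‖ := norm_add_le _ _
      _ ≤ _ := by rw [h3]; linarith
  · obtain ⟨s, hs, r, hr, h⟩ := exists_eq_mul_exp_of_turn (θ := fun t => θ t + Real.pi / 2)
      (hθc.add continuous_const) hηc hη (a := j) (b := j + 1) (by simp) (by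
        simp only [θ]
        have h1 : A * 4 + A * ((j : ℝ) ^ 3 / 3 + 4 * j) ≤
            A * (((j : ℝ) + 1) ^ 3 / 3 + 4 * (j + 1)) := by
          rw [← mul_add]
          refine mul_le_mul_of_nonneg_left ?_ (by linarith)
          nlinarith [sq_nonneg ((j : ℝ) + 1 / 2)]
        linarith [Real.pi_lt_four]) α
    refine ⟨s, hs, A * r, mul_pos (by linarith) hr, ?_⟩
    rw [hderiv, hgη, h]
    push_cast
    ring

/-- Cluster sets at one end of a curve following a sequence of points. Here `L` is the end of `ℝ`,
and `l` the corresponding end of `ℤ`, parametrised by `e`. -/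
lemma setOf_mapClusterPt_end {σ : ℝ → ℂ} {z : ℤ → ℂ}
    (hσ : ∀ (j : ℤ) (t : ℝ), t ∈ Set.Icc (j : ℝ) (j + 1) →
      ‖σ t - z j‖ ≤ 2 * ‖z (j + 1) - z j‖ + 1 / (t ^ 2 + 4))
    (hdir : ∀ (α : ℝ) (j : ℤ), ∃ s ∈ Set.Icc (j : ℝ) (j + 1), ∃ r : ℝ, 0 < r ∧
      deriv σ s = r * Complex.exp (α * Complex.I))
    {l : Filter ℤ} {L : Filter ℝ} {e : ℕ → ℤ} (he : map e atTop = l)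
    (hfloor : Tendsto (fun t : ℝ => ⌊t⌋) L l)
    (hsL : ∀ s : ℤ → ℝ, (∀ j : ℤ, s j ∈ Set.Icc (j : ℝ) (j + 1)) → Tendsto s l L)
    (hL : Tendsto (fun t : ℝ => |t|) L atTop)
    (hz : Tendsto (fun j => z (j + 1) - z j) l (𝓝 0)) :
    let K := {w : OnePoint ℂ | MapClusterPt w atTop fun k => (z (e k) : OnePoint ℂ)}
    {w : OnePoint ℂ | MapClusterPt w L fun t => (σ t : OnePoint ℂ)} = K ∧
      ∀ α : ℝ, ∃ s : ℕ → ℝ, Tendsto s atTop L ∧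
        (∀ k, ∃ r : ℝ, 0 < r ∧ deriv σ (s k) = r * Complex.exp (α * Complex.I)) ∧
        {w : OnePoint ℂ | MapClusterPt w atTop fun k => (σ (s k) : OnePoint ℂ)} = K := by
  intro K
  have hε : Tendsto (fun t : ℝ => 1 / (t ^ 2 + 4)) L (𝓝 0) := by
    have := (tendsto_atTop_add_const_right _ 4
      ((tendsto_pow_atTop two_ne_zero).comp hL)).inv_tendsto_atTop
    simpa [Function.comp_def, Pi.inv_def] using this
  have hfollow : ∀ {ι : Type} {F : Filter ι} (j : ι → ℤ) (t : ι → ℝ), Tendsto j F l →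
      Tendsto t F L → (∀ i, t i ∈ Set.Icc (j i : ℝ) (j i + 1)) →
      {w : OnePoint ℂ | MapClusterPt w F fun i => (σ (t i) : OnePoint ℂ)} =
        {w : OnePoint ℂ | MapClusterPt w F fun i => (z (j i) : OnePoint ℂ)} := by
    intro ι F j t hj ht hjt
    refine setOf_mapClusterPt_congr_of_tendsto_sub_zero
      (squeeze_zero_norm (fun i => hσ (j i) (t i) (hjt i)) ?_)
    simpa using ((hz.comp hj).norm.const_mul 2).add (hε.comp ht)
  have hmem : ∀ t : ℝ, t ∈ Set.Icc (⌊t⌋ : ℝ) (⌊t⌋ + 1) := fun t =>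
    ⟨Int.floor_le t, (Int.lt_floor_add_one t).le⟩
  have he' : Tendsto e atTop l := he.le
  refine ⟨?_, fun α => ?_⟩
  · rw [hfollow (fun t => ⌊t⌋) (fun t => t) hfloor tendsto_id hmem]
    ext w
    constructor
    · intro h
      have := MapClusterPt.of_comp (u := fun j => (z j : OnePoint ℂ)) hfloor h
      rwa [← he, ← mapClusterPt_comp] at this
    · intro h
      refine MapClusterPt.of_comp (φ := fun k => (e k : ℝ)) (p := atTop)
        ((hsL (fun j => (j : ℝ)) fun j => by simp).comp he') ?_
      simp only [Function.comp_def, Int.floor_intCast]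
      exact h
  · choose s hs hd using hdir α
    exact ⟨fun k => s (e k), (hsL s hs).comp he', fun k => hd _,
      hfollow e _ he' ((hsL s hs).comp he') fun k => hs _⟩

lemma map_negSucc_atTop : map Int.negSucc atTop = atBot := by
  refine le_antisymm ?_ ?_
  · refine tendsto_atBot.2 fun b => ?_
    filter_upwards [eventually_ge_atTop b.natAbs] with n hn
    omega
  · refine le_map_of_right_inverse (mab := Int.negSucc) (mba := fun j : ℤ => (-j - 1).toNat) ?_ ?_
    · filter_upwards [eventually_lt_atBot 0] with j hj
      simp only [Function.comp, id]
      omega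
    · refine tendsto_atTop.2 fun b => ?_
      filter_upwards [eventually_lt_atBot (-b : ℤ)] with j hj
      omega

/-- A `C¹` regular curve `σ : ℝ → ℂ` with prescribed cluster sets `K⁻` at `-∞` and
`K⁺` at `+∞`, together with parameter sequences towards each end at which the derivative is
a positive real (horizontal), respectively a positive multiple of `i` (vertical), whose image
sequences cluster exactly on the corresponding continuum. -/
theorem smooth_curve_with_prescribed_cluster_sets
    (Kneg Kpos : Set (OnePoint ℂ))
    (hKnegC : IsCompact Kneg) (hKnegConn : IsConnected Kneg)
    (hKposC : IsCompact Kpos) (hKposConn : IsConnected Kpos) :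
    ∃ σ : ℝ → ℂ, ContDiff ℝ 1 σ ∧ (∀ t : ℝ, deriv σ t ≠ 0) ∧
      -- (i) cluster sets at the two ends
      ({w : OnePoint ℂ | MapClusterPt w atBot fun t : ℝ => ((σ t : ℂ) : OnePoint ℂ)} = Kneg) ∧
      ({w : OnePoint ℂ | MapClusterPt w atTop fun t : ℝ => ((σ t : ℂ) : OnePoint ℂ)} = Kpos) ∧
      -- (ii) horizontal and vertical tangent sequences towards +∞, clustering exactly on K⁺
      (∃ s : ℕ → ℝ, Tendsto s atTop atTop ∧
        (∀ k, ∃ r : ℝ, 0 < r ∧ deriv σ (s k) = (r : ℂ)) ∧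
        {w : OnePoint ℂ | MapClusterPt w atTop fun k : ℕ => ((σ (s k) : ℂ) : OnePoint ℂ)}
          = Kpos) ∧
      (∃ s : ℕ → ℝ, Tendsto s atTop atTop ∧
        (∀ l, ∃ r : ℝ, 0 < r ∧ deriv σ (s l) = (r : ℂ) * Complex.I) ∧
        {w : OnePoint ℂ | MapClusterPt w atTop fun l : ℕ => ((σ (s l) : ℂ) : OnePoint ℂ)}
          = Kpos) ∧
      -- (iii) horizontal and vertical tangent sequences towards -∞, clustering exactly on K⁻
      (∃ s : ℕ → ℝ, Tendsto s atTop atBot ∧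
        (∀ i, ∃ r : ℝ, 0 < r ∧ deriv σ (s i) = (r : ℂ)) ∧
        {w : OnePoint ℂ | MapClusterPt w atTop fun i : ℕ => ((σ (s i) : ℂ) : OnePoint ℂ)}
          = Kneg) ∧
      (∃ s : ℕ → ℝ, Tendsto s atTop atBot ∧
        (∀ j, ∃ r : ℝ, 0 < r ∧ deriv σ (s j) = (r : ℂ) * Complex.I) ∧
        {w : OnePoint ℂ | MapClusterPt w atTop fun j : ℕ => ((σ (s j) : ℂ) : OnePoint ℂ)}
          = Kneg) := by
  obtain ⟨zp, hzp, hKp⟩ := exists_seq_setOf_mapClusterPt_eq hKposC hKposConn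
  obtain ⟨zn, hzn, hKn⟩ := exists_seq_setOf_mapClusterPt_eq hKnegC hKnegConn
  let z : ℤ → ℂ := fun j => Int.casesOn j zp zn
  have htop : Tendsto (fun j => z (j + 1) - z j) atTop (𝓝 0) := by
    rw [← Nat.map_cast_int_atTop, tendsto_map'_iff]
    exact hzp
  have hbot : Tendsto (fun j => z (j + 1) - z j) atBot (𝓝 0) := by
    rw [← map_negSucc_atTop, tendsto_map'_iff, ← tendsto_add_atTop_iff_nat 1]
    refine (show Tendsto (fun k => zn k - zn (k + 1)) atTop (𝓝 0) by simpa using hzn.neg).congr ?_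
    exact fun k => rfl
  obtain ⟨B, hB⟩ : BddAbove (Set.range fun j => ‖z (j + 1) - z j‖) := by
    refine Tendsto.bddAbove_range_of_cofinite (a := 0) ?_
    rw [Int.cofinite_eq]
    simpa using (hbot.sup htop).norm
  obtain ⟨σ, hσ1, hσ0, hσz, hdir⟩ := exists_regular_curve z fun j => hB ⟨j, rfl⟩
  obtain ⟨hp, hps⟩ := setOf_mapClusterPt_end hσz hdir Nat.map_cast_int_atTop tendsto_floor_atTop
    (fun s hs => tendsto_atTop_mono (fun j => (hs j).1) tendsto_intCast_atTop_atTop)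
    tendsto_abs_atTop_atTop htop
  obtain ⟨hn, hns⟩ := setOf_mapClusterPt_end hσz hdir map_negSucc_atTop tendsto_floor_atBot
    (fun s hs => tendsto_atBot_mono (fun j => (hs j).2)
      (tendsto_atBot_add_const_right _ _ (tendsto_intCast_atBot_iff.2 tendsto_id)))
    tendsto_abs_atBot_atTop hbot
  have h0 : Complex.exp ((0 : ℝ) * Complex.I) = 1 := by simp
  have h1 : Complex.exp ((Real.pi / 2 : ℝ) * Complex.I) = Complex.I := by
    push_cast
    exact Complex.exp_pi_div_two_mul_I
  have hp0 := hps 0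
  have hp1 := hps (Real.pi / 2)
  have hn0 := hns 0
  have hn1 := hns (Real.pi / 2)
  simp only [h0, mul_one] at hp0 hn0
  simp only [h1] at hp1 hn1
  subst hKp hKn
  exact ⟨σ, hσ1, hσ0, hn, hp, hp0, hp1, hn0, hn1⟩
end

section
/- Let a < b and L < A < R be extended-real-bounded real intervals, let γ : ℝ → ℂ be differentiable on (a, b) with deriv γ x ≠ 0 for x ∈ (a, b), let σ : ℝ → ℂ be real-analytic on (L, R) with deriv σ s ≠ 0 for s ∈ (L, R), and let τ : ℝ → ℝ be a strictly increasing function mapping (A, R) onto (a, b), differentiable on (A, R) with deriv τ s > 0, τ(s) → a as s → A⁺, and σ(s) = γ(τ(s)) for all s ∈ (A, R). Then the normalized tangent direction x ↦ deriv γ x / ‖deriv γ x‖ converges as x → a⁺ (within (a, b)), with limit deriv σ A / ‖deriv σ A‖. -/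
open Filter Topology Set

/-- The normalized tangent direction is invariant under an increasing change of parameter. -/
theorem deriv_div_norm_deriv_of_comp {γ σ : ℝ → ℂ} {τ : ℝ → ℝ} {s : ℝ}
    (hγ : DifferentiableAt ℝ γ (τ s)) (hτ : DifferentiableAt ℝ τ s) (hτ' : 0 < deriv τ s)
    (hσ : σ =ᶠ[𝓝 s] γ ∘ τ) :
    deriv σ s / ‖deriv σ s‖ = deriv γ (τ s) / ‖deriv γ (τ s)‖ := by
  rw [hσ.deriv_eq, (hγ.hasDerivAt.scomp s hτ.hasDerivAt).deriv, norm_smul, Real.norm_of_nonneg hτ'.le,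
    Complex.real_smul, Complex.ofReal_mul]
  exact mul_div_mul_left _ _ (Complex.ofReal_ne_zero.2 hτ'.ne')

/-- If the analytic curve `γ` on `(a, b)` admits an initial analytic extension `σ` on
`(L, R)` (with `A ∈ (L, R)` and an increasing change of parameter `τ : (A, R) → (a, b)`
with `σ = γ ∘ τ`), then the normalized tangent direction of `γ` converges as `t → a⁺`,
with limit the normalized tangent of `σ` at `A`. -/
theorem tangent_direction_converges_of_initial_analytic_extension
    (a b L A R : ℝ) (hab : a < b) (hLA : L < A) (hAR : A < R)
    (γ σ : ℝ → ℂ) (τ : ℝ → ℝ)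
    (hγdiff : ∀ x ∈ Ioo a b, DifferentiableAt ℝ γ x)
    (hγ' : ∀ x ∈ Ioo a b, deriv γ x ≠ 0)
    (hσan : ∀ s ∈ Ioo L R, AnalyticAt ℝ σ s)
    (hσ' : ∀ s ∈ Ioo L R, deriv σ s ≠ 0)
    (hτmono : StrictMonoOn τ (Ioo A R))
    (hτonto : τ '' Ioo A R = Ioo a b)
    (hτdiff : ∀ s ∈ Ioo A R, DifferentiableAt ℝ τ s)
    (hτ' : ∀ s ∈ Ioo A R, 0 < deriv τ s)
    (hτa : Tendsto τ (𝓝[>] A) (𝓝 a))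
    (hστ : ∀ s ∈ Ioo A R, σ s = γ (τ s)) :
    Tendsto (fun x : ℝ => deriv γ x / ‖deriv γ x‖) (𝓝[Ioo a b] a)
      (𝓝 (deriv σ A / ‖deriv σ A‖)) := by
  have hA : A ∈ Ioo L R := ⟨hLA, hAR⟩
  have hcont : ContinuousAt (fun s => deriv σ s / (‖deriv σ s‖ : ℂ)) A := by
    have hd : ContinuousAt (deriv σ) A := (hσan A hA).deriv.continuousAt
    exact hd.div (Complex.continuous_ofReal.continuousAt.comp hd.norm)
      (Complex.ofReal_ne_zero.2 (norm_ne_zero_iff.2 (hσ' A hA)))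
  intro U hU
  obtain ⟨c, hAc, hc⟩ := (mem_nhdsGT_iff_exists_Ioo_subset' hAR).1
    (mem_nhdsWithin_of_mem_nhds (hcont hU))
  obtain ⟨d, hAd, hd⟩ := exists_between (lt_min (mem_Ioi.1 hAc) hAR)
  have hdR : d ∈ Ioo A R := ⟨hAd, hd.trans_le (min_le_right _ _)⟩
  have had : a < τ d := (hτonto ▸ mem_image_of_mem τ hdR : τ d ∈ Ioo a b).1
  rw [Filter.mem_map]
  filter_upwards [self_mem_nhdsWithin, mem_nhdsWithin_of_mem_nhds (Iio_mem_nhds had)] with x hx hxd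
  obtain ⟨s, hs, rfl⟩ : x ∈ τ '' Ioo A R := hτonto ▸ hx
  have hsd : s < d := (hτmono.lt_iff_lt hs hdR).1 hxd
  have hσs : σ =ᶠ[𝓝 s] γ ∘ τ := by
    filter_upwards [isOpen_Ioo.mem_nhds hs] with t ht using hστ t ht
  have hmem := hc ⟨hs.1, hsd.trans (hd.trans_le (min_le_left _ _))⟩
  rw [mem_preimage,
    deriv_div_norm_deriv_of_comp (hγdiff _ hx) (hτdiff s hs) (hτ' s hs) hσs] at hmem
  exact hmem
end

section
/- Let γ : ℝ → ℂ be γ(t) = exp(−t² + i t). Then γ(t) → 0 as t → +∞ and as t → −∞ (so both the initial and terminal cluster sets of γ are the degenerate continuum {0}), and there is no c ∈ ℂ such that t ↦ deriv γ t / ‖deriv γ t‖ converges to c as t → +∞, nor as t → −∞. -/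
open Filter Topology

/-- A nonvanishing asymptotic modulus does not prevent `exp (i t)` from oscillating. -/
theorem not_tendsto_exp_I_mul_mul {l : Filter ℝ} [l.NeBot] {u : ℝ → ℂ} {a : ℂ} (ha : a ≠ 0)
    (hu : Tendsto u l (𝓝 a)) (hl : Tendsto (fun t : ℝ => t + Real.pi) l l) (c : ℂ) :
    ¬ Tendsto (fun t : ℝ => Complex.exp (Complex.I * t) * u t) l (𝓝 c) := by
  intro h
  have hsum : Tendsto (fun _ : ℝ => (0 : ℂ)) l (𝓝 (c * a + c * a)) := by
    refine (((h.comp hl).mul hu).add (h.mul (hu.comp hl))).congr fun t => ?_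
    have hexp : Complex.exp (Complex.I * (t + Real.pi : ℝ)) = -Complex.exp (Complex.I * t) := by
      rw [← Complex.exp_add_pi_mul_I]
      push_cast
      ring_nf
    simp only [Function.comp_apply, hexp]
    ring
  have hca : c * a + c * a = 0 := tendsto_nhds_unique hsum tendsto_const_nhds
  have hc : c = 0 := by
    rw [← two_mul] at hca
    simpa [ha] using hca
  have hnorm : ‖c‖ = ‖a‖ := by
    refine tendsto_nhds_unique h.norm (hu.norm.congr fun t => ?_)
    rw [norm_mul, mul_comm Complex.I, Complex.norm_exp_ofReal_mul_I, one_mul]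
  rw [hc, norm_zero] at hnorm
  exact ha (norm_eq_zero.1 hnorm.symm)

theorem tendsto_neg_two_add_I_div {l : Filter ℝ} (hl : Tendsto (fun t : ℝ => t⁻¹) l (𝓝 0)) :
    Tendsto (fun t : ℝ => (-2 + Complex.I * (t⁻¹ : ℝ)) / (‖-2 + Complex.I * (t⁻¹ : ℝ)‖ : ℂ)) l
      (𝓝 (-1)) := by
  have h : Tendsto (fun t : ℝ => -2 + Complex.I * (t⁻¹ : ℝ)) l (𝓝 (-2)) := by
    have h0 : Tendsto (fun t : ℝ => ((t⁻¹ : ℝ) : ℂ)) l (𝓝 ((0 : ℝ) : ℂ)) :=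
      (Complex.continuous_ofReal.tendsto 0).comp hl
    simpa using (h0.const_mul Complex.I).const_add (-2)
  have hn : Tendsto (fun t : ℝ => (‖-2 + Complex.I * (t⁻¹ : ℝ)‖ : ℂ)) l (𝓝 ((2 : ℝ) : ℂ)) := by
    simpa [Function.comp_def] using (Complex.continuous_ofReal.tendsto _).comp h.norm
  simpa [Pi.div_def] using h.div hn (by norm_num)

theorem hasDerivAt_exp_neg_sq_add_I_mul (t : ℝ) :
    HasDerivAt (fun t : ℝ => Complex.exp (-(t : ℂ) ^ 2 + Complex.I * t))
      (Complex.exp (-(t : ℂ) ^ 2 + Complex.I * t) * (-2 * t + Complex.I)) t := by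
  have h : HasDerivAt (fun z : ℂ => Complex.exp (-z ^ 2 + Complex.I * z))
      (Complex.exp (-(t : ℂ) ^ 2 + Complex.I * t) * (-2 * t + Complex.I)) (t : ℂ) := by
    have h1 := (((hasDerivAt_id (t : ℂ)).pow 2).neg.add
      ((hasDerivAt_id (t : ℂ)).const_mul Complex.I)).cexp
    exact h1.congr_deriv (by simp)
  exact h.comp_ofReal

theorem norm_exp_neg_sq_add_I_mul (t : ℝ) :
    ‖Complex.exp (-(t : ℂ) ^ 2 + Complex.I * t)‖ = Real.exp (-t ^ 2) := by
  rw [Complex.norm_exp]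
  congr 1
  simp [← Complex.ofReal_pow]

theorem tangent_direction_eq {t : ℝ} (ht : t ≠ 0) :
    deriv (fun t : ℝ => Complex.exp (-(t : ℂ) ^ 2 + Complex.I * t)) t /
        (‖deriv (fun t : ℝ => Complex.exp (-(t : ℂ) ^ 2 + Complex.I * t)) t‖ : ℂ) =
      Complex.exp (Complex.I * t) * ((t / |t| : ℝ) *
        ((-2 + Complex.I * (t⁻¹ : ℝ)) / (‖-2 + Complex.I * (t⁻¹ : ℝ)‖ : ℂ))) := by
  have hfac : (-2 * t + Complex.I : ℂ) = t * (-2 + Complex.I * (t⁻¹ : ℝ)) := by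
    have : (t : ℂ) ≠ 0 := by exact_mod_cast ht
    push_cast
    field_simp
  rw [(hasDerivAt_exp_neg_sq_add_I_mul t).deriv, norm_mul, norm_exp_neg_sq_add_I_mul, hfac,
    norm_mul, Complex.norm_real, Real.norm_eq_abs, Complex.exp_add]
  have he : Complex.exp (-(t : ℂ) ^ 2) = (Real.exp (-t ^ 2) : ℝ) := by push_cast; rfl
  rw [he]
  have he0 : ((Real.exp (-t ^ 2) : ℝ) : ℂ) ≠ 0 := by exact_mod_cast (Real.exp_pos _).ne'
  rw [Complex.ofReal_mul, Complex.ofReal_mul, Complex.ofReal_div, mul_assoc,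
    mul_div_mul_left _ _ he0]
  simp only [div_eq_mul_inv, mul_inv]
  ring

/-- Example 1: the curve `γ(t) = exp(-t² + i t)` has both ends equal to `0`, and its
normalized tangent direction diverges at both ends, so the curve is maximal. -/
theorem example_both_ends_zero
    (γ : ℝ → ℂ) (hγ : ∀ t : ℝ, γ t = Complex.exp (-(t : ℂ) ^ 2 + Complex.I * t)) :
    Tendsto γ atTop (𝓝 0) ∧ Tendsto γ atBot (𝓝 0) ∧
    (¬ ∃ c : ℂ, Tendsto (fun t : ℝ => deriv γ t / ‖deriv γ t‖) atTop (𝓝 c)) ∧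
    (¬ ∃ c : ℂ, Tendsto (fun t : ℝ => deriv γ t / ‖deriv γ t‖) atBot (𝓝 c)) := by
  obtain rfl : γ = fun t : ℝ => Complex.exp (-(t : ℂ) ^ 2 + Complex.I * t) := funext hγ
  have hzero {l : Filter ℝ} (hl : Tendsto (fun t : ℝ => t ^ 2) l atTop) :
      Tendsto (fun t : ℝ => Complex.exp (-(t : ℂ) ^ 2 + Complex.I * t)) l (𝓝 0) := by
    rw [tendsto_zero_iff_norm_tendsto_zero]
    simp only [norm_exp_neg_sq_add_I_mul]
    exact Real.tendsto_exp_neg_atTop_nhds_zero.comp hl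
  refine ⟨hzero (tendsto_pow_atTop two_ne_zero), hzero ?_, ?_, ?_⟩
  · exact ((tendsto_pow_atTop two_ne_zero).comp tendsto_neg_atBot_atTop).congr fun t => neg_sq t
  · rintro ⟨c, hc⟩
    refine not_tendsto_exp_I_mul_mul (neg_ne_zero.2 one_ne_zero)
      (tendsto_neg_two_add_I_div tendsto_inv_atTop_zero)
      (tendsto_atTop_add_const_right _ _ tendsto_id) c (hc.congr' ?_)
    filter_upwards [eventually_gt_atTop 0] with t ht
    rw [tangent_direction_eq ht.ne', abs_of_pos ht, div_self ht.ne', Complex.ofReal_one, one_mul]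
  · rintro ⟨c, hc⟩
    refine not_tendsto_exp_I_mul_mul (neg_ne_zero.2 one_ne_zero)
      (tendsto_neg_two_add_I_div tendsto_inv_atBot_zero)
      (tendsto_atBot_add_const_right _ _ tendsto_id) (-c) (hc.neg.congr' ?_)
    filter_upwards [eventually_lt_atBot 0] with t ht
    rw [tangent_direction_eq ht.ne, abs_of_neg ht, div_neg, div_self ht.ne, Complex.ofReal_neg,
      Complex.ofReal_one, neg_one_mul, mul_neg, neg_neg]
end

section
/- Let γ : ℝ → ℂ be defined on (−1, 1) by γ(s) = s + i·(s² − 1)·sin(exp(1/(1 − s²))). Then γ(s) → 1 as s → 1⁻ and γ(s) → −1 as s → −1⁺ (so the curve has the two distinct finite ends ±1), and there is no c ∈ ℂ such that s ↦ deriv γ s / ‖deriv γ s‖ converges to c as s → 1⁻, nor as s → −1⁺. -/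
open Filter Topology Set

/-- A curve which on `(-1, 1)` is the graph of `s ↦ (s ^ 2 - 1) * sin (exp (1 / (1 - s ^ 2)))`. -/
def IsOscillatingGraph (γ : ℝ → ℂ) : Prop :=
  ∀ s ∈ Ioo (-1 : ℝ) 1,
    γ s = (s : ℂ) + Complex.I * (((s ^ 2 - 1) * Real.sin (Real.exp (1 / (1 - s ^ 2))) : ℝ) : ℂ)

namespace IsOscillatingGraph

variable {γ : ℝ → ℂ} {σ : ℝ}

theorem tendsto_end (hγ : IsOscillatingGraph γ) (hσ : σ ^ 2 = 1) :
    Tendsto γ (𝓝[Ioo (-1) 1] σ) (𝓝 (σ : ℂ)) := by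
  have hid : Tendsto (fun s : ℝ => s) (𝓝[Ioo (-1) 1] σ) (𝓝 σ) :=
    tendsto_id.mono_left nhdsWithin_le_nhds
  have hfac : Tendsto (fun s : ℝ => s ^ 2 - 1) (𝓝[Ioo (-1) 1] σ) (𝓝 0) := by
    simpa [hσ] using (hid.pow 2).sub_const 1
  have hosc : Tendsto (fun s : ℝ => (s ^ 2 - 1) * Real.sin (Real.exp (1 / (1 - s ^ 2))))
      (𝓝[Ioo (-1) 1] σ) (𝓝 0) := by
    refine squeeze_zero_norm (fun s => ?_) (by simpa using hfac.norm)
    rw [norm_mul]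
    exact mul_le_of_le_one_right (norm_nonneg _) (Real.abs_sin_le_one _)
  have hsum := ((Complex.continuous_ofReal.tendsto σ).comp hid).add
    (((Complex.continuous_ofReal.tendsto 0).comp hosc).const_mul Complex.I)
  simp only [Complex.ofReal_zero, mul_zero, add_zero] at hsum
  refine hsum.congr' ?_
  filter_upwards [self_mem_nhdsWithin] with s hs
  exact (hγ s hs).symm

/-- At the parameters where `cos (exp (1 / (1 - s ^ 2)))` vanishes, the derivative stays bounded. -/
theorem deriv_eq_of_cos_eq_zero (hγ : IsOscillatingGraph γ) {s : ℝ} (hs : s ∈ Ioo (-1 : ℝ) 1)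
    (hcos : Real.cos (Real.exp (1 / (1 - s ^ 2))) = 0) :
    deriv γ s = 1 + Complex.I * ((2 * s * Real.sin (Real.exp (1 / (1 - s ^ 2))) : ℝ) : ℂ) := by
  have hne : 1 - s ^ 2 ≠ 0 := by nlinarith [hs.1, hs.2]
  have hsq : HasDerivAt (fun t : ℝ => t ^ 2) (2 * s) s := by simpa using hasDerivAt_pow 2 s
  have hinv : DifferentiableAt ℝ (fun t : ℝ => 1 / (1 - t ^ 2)) s := by fun_prop (disch := exact hne)
  have hosc := (hsq.sub_const 1).mul hinv.hasDerivAt.exp.sin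
  have hcurve := (hasDerivAt_id s).ofReal_comp.add (hosc.ofReal_comp.const_mul Complex.I)
  have heq : γ =ᶠ[𝓝 s] fun t : ℝ => (t : ℂ) +
      Complex.I * (((t ^ 2 - 1) * Real.sin (Real.exp (1 / (1 - t ^ 2))) : ℝ) : ℂ) :=
    eventually_of_mem (Ioo_mem_nhds hs.1 hs.2) hγ
  rw [heq.deriv_eq]
  refine (hcurve.deriv).trans ?_
  rw [hcos, zero_mul, mul_zero, add_zero, Complex.ofReal_one]

/-- Every value of the phase is attained modulo `2π` arbitrarily close to each end. -/
theorem exists_seq_phase (hσ : σ ^ 2 = 1) (θ : ℝ) :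
    ∃ s : ℕ → ℝ, Tendsto s atTop (𝓝[Ioo (-1) 1] σ) ∧
      ∀ᶠ n : ℕ in atTop, Real.exp (1 / (1 - s n ^ 2)) = θ + n * (2 * Real.pi) := by
  have hphase : Tendsto (fun n : ℕ => θ + n * (2 * Real.pi)) atTop atTop :=
    tendsto_atTop_add_const_left _ _
      (tendsto_natCast_atTop_atTop.atTop_mul_const Real.two_pi_pos)
  have hlog : Tendsto (fun n : ℕ => Real.log (θ + n * (2 * Real.pi))) atTop atTop :=
    Real.tendsto_log_atTop.comp hphase
  have hlim : Tendsto (fun n : ℕ => σ * √(1 - (Real.log (θ + n * (2 * Real.pi)))⁻¹))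
      atTop (𝓝 σ) := by
    simpa using ((tendsto_inv_atTop_zero.comp hlog).const_sub 1).sqrt.const_mul σ
  have hsq : ∀ᶠ n : ℕ in atTop, (σ * √(1 - (Real.log (θ + n * (2 * Real.pi)))⁻¹)) ^ 2 =
      1 - (Real.log (θ + n * (2 * Real.pi)))⁻¹ := by
    filter_upwards [hlog.eventually_gt_atTop 1] with n hn
    rw [mul_pow, hσ, one_mul, Real.sq_sqrt (sub_nonneg.2 (inv_le_one_of_one_le₀ hn.le))]
  refine ⟨_, tendsto_nhdsWithin_iff.2 ⟨hlim, ?_⟩, ?_⟩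
  · filter_upwards [hsq, hlog.eventually_gt_atTop 1] with n hn hn1
    have hpos : 0 < (Real.log (θ + n * (2 * Real.pi)))⁻¹ := inv_pos.2 (one_pos.trans hn1)
    exact abs_lt.1 ((sq_lt_one_iff_abs_lt_one _).1 (by linarith))
  · filter_upwards [hsq, hphase.eventually_gt_atTop 0] with n hn hn0
    rw [hn, sub_sub_cancel, one_div, inv_inv, Real.exp_log hn0]

theorem direction_limit_eq (hγ : IsOscillatingGraph γ) (hσ : σ ^ 2 = 1) {c : ℂ}
    (hc : Tendsto (fun s : ℝ => deriv γ s / ‖deriv γ s‖) (𝓝[Ioo (-1) 1] σ) (𝓝 c))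
    {θ : ℝ} (hθ : Real.cos θ = 0) :
    c = (1 + Complex.I * ((2 * σ * Real.sin θ : ℝ) : ℂ)) /
      ‖1 + Complex.I * ((2 * σ * Real.sin θ : ℝ) : ℂ)‖ := by
  obtain ⟨s, hs, hphase⟩ := exists_seq_phase hσ θ
  have hderiv : Tendsto (fun n => deriv γ (s n)) atTop
      (𝓝 (1 + Complex.I * ((2 * σ * Real.sin θ : ℝ) : ℂ))) := by
    have hreal := ((tendsto_nhdsWithin_iff.1 hs).1.const_mul 2).mul_const (Real.sin θ)
    refine ((((Complex.continuous_ofReal.tendsto _).comp hreal).const_mul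
      Complex.I).const_add 1).congr' ?_
    filter_upwards [hphase, (tendsto_nhdsWithin_iff.1 hs).2] with n hn hmem
    rw [hγ.deriv_eq_of_cos_eq_zero hmem (by rw [hn, Real.cos_add_nat_mul_two_pi, hθ]), hn,
      Real.sin_add_nat_mul_two_pi]
    rfl
  have hne : 1 + Complex.I * ((2 * σ * Real.sin θ : ℝ) : ℂ) ≠ 0 := fun h => by
    simpa using congrArg Complex.re h
  refine tendsto_nhds_unique (hc.comp hs) (hderiv.div
    ((Complex.continuous_ofReal.tendsto _).comp hderiv.norm) ?_)
  exact_mod_cast norm_ne_zero_iff.2 hne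

theorem not_tendsto_direction (hγ : IsOscillatingGraph γ) (hσ : σ ^ 2 = 1) :
    ¬ ∃ c : ℂ, Tendsto (fun s : ℝ => deriv γ s / ‖deriv γ s‖) (𝓝[Ioo (-1) 1] σ) (𝓝 c) := by
  rintro ⟨c, hc⟩
  have h_im (x : ℝ) :
      ((1 + Complex.I * (x : ℂ)) / (‖1 + Complex.I * (x : ℂ)‖ : ℂ)).im =
        x / √(1 + x ^ 2) := by
    rw [Complex.div_ofReal_im, mul_comm, ← Complex.ofReal_one, Complex.norm_add_mul_I]
    simp
  have hplus := congrArg Complex.im (hγ.direction_limit_eq hσ hc Real.cos_pi_div_two)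
  have hminus := congrArg Complex.im
    (hγ.direction_limit_eq hσ hc (θ := -(Real.pi / 2)) (by simp))
  rw [h_im] at hplus hminus
  simp only [Real.sin_neg, Real.sin_pi_div_two, mul_neg, mul_one, neg_sq, neg_div] at hplus hminus
  have hzero : 2 * σ / √(1 + (2 * σ) ^ 2) = 0 := by linarith
  have hsqrt : √(1 + (2 * σ) ^ 2) ≠ 0 := by positivity
  have hσ0 : σ = 0 := by simpa [hsqrt] using hzero
  simp [hσ0] at hσ

end IsOscillatingGraph

/-- Example 2: the curve `γ(s) = s + i(s² - 1)·sin(exp(1/(1 - s²)))` on `(-1, 1)` has the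
two distinct finite ends `±1`, and its normalized tangent direction diverges at both ends,
so the curve is maximal. -/
theorem example_two_distinct_finite_ends
    (γ : ℝ → ℂ)
    (hγ : ∀ s ∈ Ioo (-1 : ℝ) 1,
      γ s = (s : ℂ) + Complex.I * (((s ^ 2 - 1) * Real.sin (Real.exp (1 / (1 - s ^ 2))) : ℝ) : ℂ)) :
    Tendsto γ (𝓝[<] (1 : ℝ)) (𝓝 1) ∧
    Tendsto γ (𝓝[>] (-1 : ℝ)) (𝓝 (-1)) ∧
    (¬ ∃ c : ℂ, Tendsto (fun s : ℝ => deriv γ s / ‖deriv γ s‖) (𝓝[<] (1 : ℝ)) (𝓝 c)) ∧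
    (¬ ∃ c : ℂ, Tendsto (fun s : ℝ => deriv γ s / ‖deriv γ s‖) (𝓝[>] (-1 : ℝ)) (𝓝 c)) := by
  have hgraph : IsOscillatingGraph γ := hγ
  rw [← nhdsWithin_Ioo_eq_nhdsLT (show (-1 : ℝ) < 1 by norm_num),
    ← nhdsWithin_Ioo_eq_nhdsGT (show (-1 : ℝ) < 1 by norm_num)]
  refine ⟨?_, ?_, hgraph.not_tendsto_direction (by norm_num),
    hgraph.not_tendsto_direction (by norm_num)⟩
  · simpa using hgraph.tendsto_end (σ := 1) (by norm_num)
  · simpa using hgraph.tendsto_end (σ := -1) (by norm_num)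
end

section
/- Let γ : ℝ → ℂ be γ(t) = exp(t² + i t). Then ‖γ(t)‖ → +∞ as t → +∞ and as t → −∞ (so both ends of the curve are the point ∞ of the Riemann sphere OnePoint ℂ), and there is no c ∈ ℂ such that t ↦ deriv γ t / ‖deriv γ t‖ converges to c as t → +∞, nor as t → −∞. -/
open Filter Topology

lemma hasDerivAt_exp_sq_add_I_mul (t : ℝ) :
    HasDerivAt (fun s : ℝ => Complex.exp ((s : ℂ) ^ 2 + Complex.I * s))
      (Complex.exp ((t : ℂ) ^ 2 + Complex.I * t) * (2 * t + Complex.I)) t := by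
  have h : HasDerivAt (fun z : ℂ => Complex.exp (z ^ 2 + Complex.I * z))
      (Complex.exp ((t : ℂ) ^ 2 + Complex.I * t) * (2 * t + Complex.I)) t := by
    have h₁ : HasDerivAt (fun z : ℂ => z ^ 2 + Complex.I * z) (2 * t + Complex.I) (t : ℂ) := by
      simpa using (hasDerivAt_pow 2 (t : ℂ)).fun_add ((hasDerivAt_id (t : ℂ)).const_mul Complex.I)
    exact h₁.cexp
  exact h.comp_ofReal

lemma norm_exp_sq_add_I_mul (t : ℝ) :
    ‖Complex.exp ((t : ℂ) ^ 2 + Complex.I * t)‖ = Real.exp (t ^ 2) := by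
  rw [Complex.norm_exp]
  simp [← Complex.ofReal_pow]

/-- The tangent vectors at parameters differing by `π` make an obtuse angle when `t (t + π) ≥ 0`. -/
lemma re_tangent_mul_conj_nonpos {t : ℝ} (ht : 0 ≤ t * (t + Real.pi)) :
    ((Complex.exp (((t + Real.pi : ℝ) : ℂ) ^ 2 + Complex.I * (t + Real.pi : ℝ)) *
        (2 * (t + Real.pi : ℝ) + Complex.I)) *
      (starRingEnd ℂ) (Complex.exp ((t : ℂ) ^ 2 + Complex.I * t) * (2 * t + Complex.I))).re ≤ 0 := by
  have hre (s : ℝ) : (Complex.exp ((s : ℂ) ^ 2 + Complex.I * s)).re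
      = Real.exp (s ^ 2) * Real.cos s := by
    simp [Complex.exp_re, ← Complex.ofReal_pow]
  have him (s : ℝ) : (Complex.exp ((s : ℂ) ^ 2 + Complex.I * s)).im
      = Real.exp (s ^ 2) * Real.sin s := by
    simp [Complex.exp_im, ← Complex.ofReal_pow]
  have h₀ : 0 ≤ Real.exp ((t + Real.pi) ^ 2) * Real.exp (t ^ 2) *
      (4 * (t * (t + Real.pi)) + 1) := by positivity
  simp only [Complex.mul_re, Complex.mul_im, Complex.conj_re, Complex.conj_im, hre, him,
    Complex.add_re, Complex.add_im, Complex.ofReal_re, Complex.ofReal_im, Complex.I_re,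
    Complex.I_im, Complex.re_ofNat, Complex.im_ofNat, Real.cos_add_pi, Real.sin_add_pi]
  linear_combination h₀ + (-Real.exp ((t + Real.pi) ^ 2) * Real.exp (t ^ 2) *
      (4 * (t * (t + Real.pi)) + 1)) * Real.sin_sq_add_cos_sq t

lemma not_tendsto_unit_tangent {l : Filter ℝ} [l.NeBot]
    (hl : Tendsto (fun t => t + Real.pi) l l) (hpos : ∀ᶠ t in l, 0 ≤ t * (t + Real.pi))
    {D : ℝ → ℂ}
    (hD : ∀ t : ℝ, D t = Complex.exp ((t : ℂ) ^ 2 + Complex.I * t) * (2 * t + Complex.I)) :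
    ¬ ∃ c : ℂ, Tendsto (fun t : ℝ => D t / ‖D t‖) l (𝓝 c) := by
  rintro ⟨c, hc⟩
  have hne (t : ℝ) : D t ≠ 0 := by
    rw [hD]
    refine mul_ne_zero (Complex.exp_ne_zero _) fun h => ?_
    simpa using congrArg Complex.im h
  have hnorm : ‖c‖ = 1 := by
    refine tendsto_nhds_unique hc.norm (tendsto_const_nhds.congr fun t => ?_)
    simp [hne t]
  have hlim : Tendsto (fun t : ℝ => ((D (t + Real.pi) / ‖D (t + Real.pi)‖) *
      (starRingEnd ℂ) (D t / ‖D t‖)).re) l (𝓝 (c * (starRingEnd ℂ) c).re) :=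
    (Complex.continuous_re.tendsto _).comp
      ((hc.comp hl).mul ((Complex.continuous_conj.tendsto c).comp hc))
  have hle : (c * (starRingEnd ℂ) c).re ≤ 0 := by
    refine le_of_tendsto hlim (hpos.mono fun t ht => ?_)
    have heq : (D (t + Real.pi) / ‖D (t + Real.pi)‖) * (starRingEnd ℂ) (D t / ‖D t‖) =
        D (t + Real.pi) * (starRingEnd ℂ) (D t) / (‖D (t + Real.pi)‖ * ‖D t‖ : ℝ) := by
      rw [map_div₀, Complex.conj_ofReal, div_mul_div_comm, Complex.ofReal_mul]
    rw [heq, Complex.div_ofReal_re]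
    refine div_nonpos_of_nonpos_of_nonneg ?_ (by positivity)
    rw [hD, hD]
    exact re_tangent_mul_conj_nonpos ht
  rw [Complex.mul_conj, Complex.ofReal_re, Complex.normSq_eq_norm_sq, hnorm] at hle
  norm_num at hle

/-- Example 4: the curve `γ(t) = exp(t² + i t)` has both ends equal to `∞`, and its
normalized tangent direction diverges at both ends, so the curve is maximal. -/
theorem example_both_ends_infinite
    (γ : ℝ → ℂ) (hγ : ∀ t : ℝ, γ t = Complex.exp ((t : ℂ) ^ 2 + Complex.I * t)) :
    Tendsto (fun t : ℝ => ‖γ t‖) atTop atTop ∧ Tendsto (fun t : ℝ => ‖γ t‖) atBot atTop ∧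
    (¬ ∃ c : ℂ, Tendsto (fun t : ℝ => deriv γ t / ‖deriv γ t‖) atTop (𝓝 c)) ∧
    (¬ ∃ c : ℂ, Tendsto (fun t : ℝ => deriv γ t / ‖deriv γ t‖) atBot (𝓝 c)) := by
  have hnorm : (fun t : ℝ => ‖γ t‖) = fun t => Real.exp (t ^ 2) := by
    funext t
    rw [hγ, norm_exp_sq_add_I_mul]
  have hD (t : ℝ) :
      deriv γ t = Complex.exp ((t : ℂ) ^ 2 + Complex.I * t) * (2 * t + Complex.I) := by
    rw [funext hγ]
    exact (hasDerivAt_exp_sq_add_I_mul t).deriv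
  rw [hnorm]
  refine ⟨Real.tendsto_exp_atTop.comp (tendsto_pow_atTop two_ne_zero),
    Real.tendsto_exp_atTop.comp ?_,
    not_tendsto_unit_tangent (tendsto_atTop_add_const_right _ _ tendsto_id) ?_ hD,
    not_tendsto_unit_tangent (tendsto_atBot_add_const_right _ _ tendsto_id) ?_ hD⟩
  · simpa [Function.comp_def] using
      (tendsto_pow_atTop (α := ℝ) two_ne_zero).comp tendsto_neg_atBot_atTop
  · filter_upwards [eventually_ge_atTop 0] with t ht
    positivity
  · filter_upwards [eventually_le_atBot (-Real.pi)] with t ht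
    exact mul_nonneg_of_nonpos_of_nonpos (by linarith [Real.pi_pos]) (by linarith)
end

section
/- (Hoischen's approximation theorem, as used in the paper.) For every continuously differentiable function σ : ℝ → ℂ and every continuous function ε : ℝ → ℝ with ε(t) > 0 for all t, there exists an entire function f : ℂ → ℂ such that |f(t) − σ(t)| < ε(t) and |deriv f t − deriv σ t| < ε(t) for all t ∈ ℝ. -/
open Filter Topology MeasureTheory ProbabilityTheory
open scoped NNReal

/-- Convolving a compactly supported continuous function on `ℝ` with an entire kernel produces an
entire function. -/
lemma differentiable_integral_comp_sub_mul {k : ℂ → ℂ} (hk : Differentiable ℂ k)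
    {τ : ℝ → ℂ} (hτ : Continuous τ) (hc : HasCompactSupport τ) :
    Differentiable ℂ fun z : ℂ ↦ ∫ s : ℝ, k (z - s) * τ s := by
  intro z₀
  have hk' : Continuous (deriv k) := (hk.contDiff (n := 1)).continuous_deriv le_rfl
  obtain ⟨C, hC⟩ := ((isCompact_closedBall z₀ 1).prod hc.isCompact).exists_bound_of_continuousOn
    (f := fun p : ℂ × ℝ ↦ deriv k (p.1 - p.2)) (by fun_prop)
  refine (hasDerivAt_integral_of_dominated_loc_of_deriv_le
    (F := fun z s ↦ k (z - s) * τ s) (F' := fun z s ↦ deriv k (z - s) * τ s)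
    (bound := fun s ↦ C * ‖τ s‖) (Metric.closedBall_mem_nhds z₀ one_pos)
    (Eventually.of_forall fun z ↦ ?_) ?_ ?_ (Eventually.of_forall fun s z hz ↦ ?_) ?_
    (Eventually.of_forall fun s z hz ↦ ?_)).2.differentiableAt
  · have := hk.continuous
    exact Continuous.aestronglyMeasurable (by fun_prop)
  · have := hk.continuous
    exact Continuous.integrable_of_hasCompactSupport (by fun_prop) hc.mul_left
  · exact Continuous.aestronglyMeasurable (by fun_prop)
  · by_cases hs : s ∈ tsupport τ
    · rw [norm_mul]
      gcongr
      exact hC (z, s) ⟨hz, hs⟩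
    · simp [image_eq_zero_of_notMem_tsupport hs]
  · exact (hτ.norm.integrable_of_hasCompactSupport hc.norm).const_mul C
  · exact (((hk (z - s)).hasDerivAt).comp_sub_const z (s : ℂ)).mul_const (τ s)

/-- The entire function extending the convolution of `τ` with the Gaussian density of variance
`v`. -/
noncomputable def gaussianSmoothing (v : ℝ≥0) (τ : ℝ → ℂ) (z : ℂ) : ℂ :=
  ∫ s : ℝ, ((√(2 * Real.pi * v))⁻¹ : ℝ) * Complex.exp (-(z - s) ^ 2 / (2 * v)) * τ s

lemma differentiable_gaussianSmoothing (v : ℝ≥0) {τ : ℝ → ℂ} (hτ : Continuous τ)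
    (hc : HasCompactSupport τ) : Differentiable ℂ (gaussianSmoothing v τ) :=
  differentiable_integral_comp_sub_mul
    (k := fun z ↦ ((√(2 * Real.pi * v))⁻¹ : ℝ) * Complex.exp (-z ^ 2 / (2 * v)))
    (by fun_prop) hτ hc

lemma gaussianSmoothing_ofReal {v : ℝ≥0} (hv : v ≠ 0) (τ : ℝ → ℂ) (x : ℝ) :
    gaussianSmoothing v τ x = ∫ s, τ (x - s) ∂gaussianReal 0 v := by
  rw [integral_gaussianReal_eq_integral_smul hv, gaussianSmoothing,
    ← integral_sub_left_eq_self _ volume x]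
  congr 1 with s
  rw [Complex.real_smul, gaussianPDFReal]
  push_cast
  ring_nf

lemma hasDerivAt_integral_comp_sub {μ : Measure ℝ} [IsFiniteMeasure μ] {τ : ℝ → ℂ}
    (hτ : ContDiff ℝ 1 τ) (hc : HasCompactSupport τ) (x : ℝ) :
    HasDerivAt (fun x ↦ ∫ s, τ (x - s) ∂μ) (∫ s, deriv τ (x - s) ∂μ) x := by
  have hτ' : Continuous (deriv τ) := hτ.continuous_deriv le_rfl
  have hτc := hτ.continuous
  obtain ⟨C, hC⟩ := hc.deriv.exists_bound_of_continuous hτ'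
  obtain ⟨D, hD⟩ := hc.exists_bound_of_continuous hτc
  refine (hasDerivAt_integral_of_dominated_loc_of_deriv_le
    (F := fun x s ↦ τ (x - s)) (F' := fun x s ↦ deriv τ (x - s))
    (bound := fun _ ↦ C) univ_mem
    (Eventually.of_forall fun z ↦ ?_) ?_ ?_ (Eventually.of_forall fun s z _ ↦ hC _)
    (integrable_const C) (Eventually.of_forall fun s z _ ↦ ?_)).2
  · exact Continuous.aestronglyMeasurable (by fun_prop)
  · exact Integrable.of_bound (Continuous.aestronglyMeasurable (by fun_prop)) D
      (Eventually.of_forall fun s ↦ hD _)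
  · exact Continuous.aestronglyMeasurable (by fun_prop)
  · exact ((hτ.differentiable one_ne_zero _).hasDerivAt).comp_sub_const z s

lemma deriv_gaussianSmoothing_ofReal {v : ℝ≥0} (hv : v ≠ 0) {τ : ℝ → ℂ} (hτ : ContDiff ℝ 1 τ)
    (hc : HasCompactSupport τ) (x : ℝ) :
    deriv (gaussianSmoothing v τ) x = ∫ s, deriv τ (x - s) ∂gaussianReal 0 v := by
  have h₁ := (differentiable_gaussianSmoothing v hτ.continuous hc x).hasDerivAt.comp_ofReal
  simp_rw [gaussianSmoothing_ofReal hv] at h₁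
  exact h₁.unique (hasDerivAt_integral_comp_sub hτ hc x)

/-- Smoothing a compactly supported continuous function by Gaussians of vanishing variance
converges uniformly. -/
lemma eventually_forall_norm_integral_gaussianReal_sub_le {φ : ℝ → ℂ} (hφ : Continuous φ)
    (hc : HasCompactSupport φ) {η : ℝ} (hη : 0 < η) :
    ∀ᶠ v : ℝ≥0 in 𝓝 0, ∀ x, ‖∫ s, φ (x - s) ∂gaussianReal 0 v - φ x‖ ≤ η := by
  obtain ⟨D, hD⟩ := hc.exists_bound_of_continuous hφ
  have hD0 : 0 ≤ D := (norm_nonneg _).trans (hD 0)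
  obtain ⟨δ, hδ, hφδ⟩ := Metric.uniformContinuous_iff.1
    (hc.uniformContinuous_of_continuous hφ) (η / 2) (by positivity)
  have hlim : Tendsto (fun v : ℝ≥0 ↦ η / 2 + 2 * D / δ ^ 2 * v) (𝓝 0) (𝓝 (η / 2)) := by
    have : Continuous (fun v : ℝ≥0 ↦ η / 2 + 2 * D / δ ^ 2 * v) := by fun_prop
    simpa using this.tendsto 0
  filter_upwards [hlim.eventually_le_const (half_lt_self hη)] with v hv x
  have hpt (s : ℝ) : ‖φ (x - s) - φ x‖ ≤ η / 2 + 2 * D / δ ^ 2 * s ^ 2 := by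
    rcases lt_or_ge |s| δ with hs | hs
    · have := hφδ (a := x - s) (b := x) (by simpa [Real.dist_eq] using hs)
      rw [dist_eq_norm] at this
      have : 0 ≤ 2 * D / δ ^ 2 * s ^ 2 := by positivity
      linarith
    · have h1 : 1 ≤ s ^ 2 / δ ^ 2 := by
        rw [one_le_div (by positivity), ← sq_abs s]
        gcongr
      have h2 : 2 * D ≤ 2 * D * (s ^ 2 / δ ^ 2) := le_mul_of_one_le_right (by positivity) h1
      have h3 := norm_sub_le_of_le (hD (x - s)) (hD x)
      rw [div_mul_eq_mul_div, mul_div_assoc]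
      linarith
  have hsq : Integrable (fun s : ℝ ↦ s ^ 2) (gaussianReal 0 v) :=
    (memLp_id_gaussianReal (μ := 0) (v := v) 2).integrable_sq
  have hvar : ∫ s, s ^ 2 ∂gaussianReal 0 v = v := by
    have := variance_fun_id_gaussianReal (μ := 0) (v := v)
    rw [variance_eq_integral measurable_id'.aemeasurable] at this
    simpa using this
  calc ‖∫ s, φ (x - s) ∂gaussianReal 0 v - φ x‖
      = ‖∫ s, (φ (x - s) - φ x) ∂gaussianReal 0 v‖ := by
        rw [integral_sub _ (integrable_const _)]
        · simp
        · exact Integrable.of_bound (Continuous.aestronglyMeasurable (by fun_prop)) D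
            (Eventually.of_forall fun s ↦ hD _)
    _ ≤ ∫ s, (η / 2 + 2 * D / δ ^ 2 * s ^ 2) ∂gaussianReal 0 v :=
        norm_integral_le_of_norm_le ((integrable_const _).add (hsq.const_mul _))
          (Eventually.of_forall hpt)
    _ = η / 2 + 2 * D / δ ^ 2 * v := by
        rw [integral_add (integrable_const _) (hsq.const_mul _), integral_const_mul, hvar]
        simp
    _ ≤ η := hv

lemma eventually_forall_norm_gaussianSmoothing_le {τ : ℝ → ℂ} (hτ : Continuous τ)
    (hc : HasCompactSupport τ) {r : ℝ} (hr : ∀ s, |s| < r → τ s = 0) {η : ℝ} (hη : 0 < η) :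
    ∀ᶠ v : ℝ≥0 in 𝓝 0, ∀ z ∈ Metric.ball (0 : ℂ) (r / 3), ‖gaussianSmoothing v τ z‖ ≤ η := by
  rcases le_or_gt r 0 with hr0 | hr0
  · simp [Metric.ball_eq_empty.2 (by linarith : r / 3 ≤ 0)]
  set M := ∫ s, ‖τ s‖
  have hlim : Tendsto (fun v : ℝ≥0 ↦ 6 / r ^ 2 * √v * M) (𝓝 0) (𝓝 0) := by
    have : Continuous (fun v : ℝ≥0 ↦ 6 / r ^ 2 * √v * M) := by fun_prop
    simpa using this.tendsto 0
  filter_upwards [hlim.eventually_le_const hη] with v hv z hz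
  rw [mem_ball_zero_iff] at hz
  refine le_trans ?_ hv
  rcases eq_or_ne v 0 with rfl | hv0
  · simp [gaussianSmoothing]
  have hvpos : (0 : ℝ) < v := by positivity
  rw [← integral_const_mul]
  refine norm_integral_le_of_norm_le
    ((hτ.norm.integrable_of_hasCompactSupport hc.norm).const_mul _)
    (Eventually.of_forall fun s ↦ ?_)
  rcases lt_or_ge |s| r with hs | hs
  · simp [hr s hs]
  rw [norm_mul, norm_mul]
  refine mul_le_mul_of_nonneg_right ?_ (norm_nonneg _)
  have hre : (-(z - s) ^ 2 / (2 * v)).re = (z.im ^ 2 - (z.re - s) ^ 2) / (2 * v) := by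
    have : (-(z - s) ^ 2 / (2 * (v : ℝ))) = (-(z - s) ^ 2) / ((2 * v : ℝ) : ℂ) := by push_cast; rfl
    erw [this, Complex.div_ofReal_re]
    congr 1
    simp [sq]
  have him := (Complex.abs_im_le_norm z).trans hz.le
  have hree := (Complex.abs_re_le_norm z).trans hz.le
  have h1 : z.im ^ 2 ≤ (r / 3) ^ 2 := sq_le_sq' (by linarith [abs_le.1 him]) (abs_le.1 him).2
  have h2 : 2 * r / 3 ≤ |z.re - s| := by
    have := abs_sub_abs_le_abs_sub s z.re
    rw [abs_sub_comm] at this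
    linarith
  have h3 : (2 * r / 3) ^ 2 ≤ (z.re - s) ^ 2 := by
    rw [← sq_abs (z.re - s)]
    gcongr
  have h4 : (z.im ^ 2 - (z.re - s) ^ 2) / (2 * v) ≤ -(r ^ 2 / (6 * v)) := by
    rw [div_le_iff₀ (by positivity)]
    field_simp
    linarith
  have h5 : Real.exp (-(r ^ 2 / (6 * v))) ≤ 6 * v / r ^ 2 := by
    rw [Real.exp_neg]
    have := Real.add_one_le_exp (r ^ 2 / (6 * v : ℝ))
    calc _ ≤ (r ^ 2 / (6 * v : ℝ))⁻¹ := by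
          gcongr
          linarith
      _ = _ := by rw [inv_div]
  have h6 : (√(2 * Real.pi * v))⁻¹ ≤ (√v)⁻¹ := by
    gcongr
    nlinarith [Real.pi_gt_three]
  rw [Complex.norm_real, Real.norm_of_nonneg (by positivity), Complex.norm_exp, hre]
  calc _ ≤ (√v)⁻¹ * (6 * v / r ^ 2) := by
        gcongr
        exact (Real.exp_le_exp.2 h4).trans h5
    _ = 6 / r ^ 2 * √v := by
        have := Real.sq_sqrt hvpos.le
        have : 0 < √(v : ℝ) := by positivity
        field_simp
        linarith

/-- A compactly supported `C¹` function can be uniformly approximated, together with its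
derivative, by an entire function that is small on a disc avoiding the support. -/
lemma exists_entire_approx_of_hasCompactSupport {τ : ℝ → ℂ} (hτ : ContDiff ℝ 1 τ)
    (hc : HasCompactSupport τ) {r : ℝ} (hr : ∀ s, |s| < r → τ s = 0) {η : ℝ} (hη : 0 < η) :
    ∃ g : ℂ → ℂ, Differentiable ℂ g ∧ (∀ x : ℝ, ‖g x - τ x‖ ≤ η) ∧
      (∀ x : ℝ, ‖deriv g x - deriv τ x‖ ≤ η) ∧ ∀ z ∈ Metric.ball (0 : ℂ) (r / 3), ‖g z‖ ≤ η := by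
  have hne : ∀ᶠ v : ℝ≥0 in 𝓝[≠] 0, v ≠ 0 := eventually_mem_nhdsWithin
  obtain ⟨v, hv, h₀, h₁, h₂⟩ := (hne.and (nhdsWithin_le_nhds
    ((eventually_forall_norm_integral_gaussianReal_sub_le hτ.continuous hc hη).and
      ((eventually_forall_norm_integral_gaussianReal_sub_le
        (hτ.continuous_deriv le_rfl) hc.deriv hη).and
      (eventually_forall_norm_gaussianSmoothing_le hτ.continuous hc hr hη))))).exists
  refine ⟨gaussianSmoothing v τ, differentiable_gaussianSmoothing v hτ.continuous hc,
    fun x ↦ ?_, fun x ↦ ?_, h₂⟩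
  · rw [gaussianSmoothing_ofReal hv]
    exact h₀ x
  · rw [deriv_gaussianSmoothing_ofReal hv hτ hc]
    exact h₁ x

/-- A series of entire functions dominated by a summable sequence on discs growing to the whole
plane can be differentiated termwise. -/
lemma differentiable_tsum_and_hasSum_deriv {g : ℕ → ℂ → ℂ} (hg : ∀ n, Differentiable ℂ (g n))
    {η : ℕ → ℝ} (hη : Summable η) {R : ℕ → ℝ} (hR : Tendsto R atTop atTop)
    (hle : ∀ n, ∀ z ∈ Metric.ball (0 : ℂ) (R n), ‖g n z‖ ≤ η n) :
    Differentiable ℂ (fun z ↦ ∑' n, g n z) ∧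
      ∀ z, HasSum (fun n ↦ g n z) (∑' n, g n z) ∧
        HasSum (fun n ↦ deriv (g n) z) (deriv (fun z ↦ ∑' n, g n z) z) := by
  have hsum : SummableLocallyUniformlyOn g Set.univ := by
    refine SummableLocallyUniformlyOn.of_locally_bounded_eventually isOpen_univ fun K _ hK ↦
      ⟨η, hη, ?_⟩
    obtain ⟨C, hC⟩ := hK.isBounded.exists_norm_le
    rw [Nat.cofinite_eq_atTop]
    filter_upwards [hR.eventually_gt_atTop C] with n hn z hz
    exact hle n z (mem_ball_zero_iff.2 ((hC z hz).trans_lt hn))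
  have hlim := hasSumLocallyUniformlyOn_iff_tendstoLocallyUniformlyOn.1
    hsum.hasSumLocallyUniformlyOn
  have hd : ∀ s : Finset ℕ, DifferentiableOn ℂ (fun z ↦ ∑ n ∈ s, g n z) Set.univ := fun s ↦
    DifferentiableOn.fun_sum fun n _ ↦ (hg n).differentiableOn
  refine ⟨differentiableOn_univ.1
    (hlim.differentiableOn (Eventually.of_forall hd) isOpen_univ), fun z ↦
    ⟨(hsum.summable (Set.mem_univ z)).hasSum, ?_⟩⟩
  refine ((hlim.deriv (Eventually.of_forall hd) isOpen_univ).tendsto_at (Set.mem_univ z)).congr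
    fun s ↦ ?_
  exact deriv_fun_sum fun n _ ↦ hg n z

lemma hasSum_sub_of_eventuallyEq {E : Type*} [AddCommGroup E] [TopologicalSpace E] {a : ℕ → E}
    {l : E} {N : ℕ} (ha : ∀ n ≥ N, a n = l) : HasSum (fun n ↦ a (n + 1) - a n) (l - a 0) := by
  have h := hasSum_sum_of_ne_finset_zero (f := fun n ↦ a (n + 1) - a n) (s := Finset.range N)
    (L := .unconditional ℕ)
    fun n hn ↦ by
      rw [Finset.mem_range, not_lt] at hn
      simp [ha n hn, ha (n + 1) (by omega)]
  rwa [Finset.sum_range_sub, ha N le_rfl] at h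

/-- Every `C¹` curve on the real line can be uniformly approximated, together with its derivative,
by an entire function. -/
lemma exists_entire_approx_uniform {u : ℝ → ℂ} (hu : ContDiff ℝ 1 u) {δ : ℝ} (hδ : 0 < δ) :
    ∃ F : ℂ → ℂ, Differentiable ℂ F ∧ (∀ x : ℝ, ‖F x - u x‖ ≤ δ) ∧
      ∀ x : ℝ, ‖deriv F x - deriv u x‖ ≤ δ := by
  let χ (n : ℕ) : ContDiffBump (0 : ℝ) := ⟨n + 1, n + 2, by positivity, by linarith⟩
  let T (n : ℕ) (x : ℝ) : ℂ := χ n x • u x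
  have hT (n : ℕ) : ContDiff ℝ 1 (T n) := (χ n).contDiff.smul hu
  have hTc (n : ℕ) : HasCompactSupport (T n) := (χ n).hasCompactSupport.smul_right
  have hTu (n : ℕ) (x : ℝ) (hx : |x| < n + 1) : T n x = u x := by
    have : χ n x = 1 := (χ n).one_of_mem_closedBall (by simpa [χ] using hx.le)
    simp [T, this]
  have hTu' (n : ℕ) (x : ℝ) (hx : |x| < n + 1) : deriv (T n) x = deriv u x := by
    refine EventuallyEq.deriv_eq ?_
    filter_upwards [(isOpen_lt continuous_abs continuous_const).mem_nhds hx] with y hy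
    exact hTu n y hy
  have hTd (n : ℕ) : Differentiable ℝ (T n) := (hT n).differentiable one_ne_zero
  obtain ⟨G, hG, hG₀, hG₁, -⟩ := exists_entire_approx_of_hasCompactSupport (hT 0) (hTc 0)
    (r := 0) (fun s hs ↦ absurd hs (abs_nonneg s).not_gt) (half_pos hδ)
  have hstep (n : ℕ) := exists_entire_approx_of_hasCompactSupport
    (τ := fun x ↦ T (n + 1) x - T n x) ((hT (n + 1)).sub (hT n)) ((hTc (n + 1)).sub (hTc n))
    (r := n + 1) (fun s hs ↦ by
      rw [hTu n s hs, hTu (n + 1) s (by push_cast; linarith), sub_self])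
    (η := δ / 2 / 2 / 2 ^ n) (by positivity)
  choose g hg hg₀ hg₁ hg₂ using hstep
  have hη := hasSum_geometric_two' (δ / 2)
  have hR : Tendsto (fun n : ℕ ↦ ((n : ℝ) + 1) / 3) atTop atTop :=
    (tendsto_atTop_add_const_right _ _ tendsto_natCast_atTop_atTop).atTop_div_const (by norm_num)
  obtain ⟨hS, hsum⟩ := differentiable_tsum_and_hasSum_deriv hg hη.summable hR hg₂
  set S : ℂ → ℂ := fun z ↦ ∑' n, g n z
  refine ⟨fun z ↦ G z + S z, hG.add hS, fun x ↦ ?_, fun x ↦ ?_⟩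
  all_goals
    obtain ⟨N, hN⟩ := exists_nat_gt |x|
    have hNn (n : ℕ) (hn : N ≤ n) : |x| < n + 1 := by
      have : (N : ℝ) ≤ n := by exact_mod_cast hn
      linarith
  · have h := ((hsum x).1.sub (hasSum_sub_of_eventuallyEq (a := fun n ↦ T n x)
      fun n hn ↦ hTu n x (hNn n hn))).norm_le_of_bounded hη fun n ↦ hg₀ n x
    calc ‖G x + S x - u x‖ = ‖(G x - T 0 x) + (S x - (u x - T 0 x))‖ := by congr 1; ring
      _ ≤ δ / 2 + δ / 2 := norm_add_le_of_le (hG₀ x) h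
      _ = δ := add_halves δ
  · have h := ((hsum x).2.sub (hasSum_sub_of_eventuallyEq (a := fun n ↦ deriv (T n) x)
      fun n hn ↦ hTu' n x (hNn n hn))).norm_le_of_bounded hη fun n ↦ by
        have := hg₁ n x
        rwa [deriv_fun_sub (hTd _ x) (hTd _ x)] at this
    rw [deriv_fun_add (hG x) (hS x)]
    calc ‖deriv G x + deriv S x - deriv u x‖
        = ‖(deriv G x - deriv (T 0) x) + (deriv S x - (deriv u x - deriv (T 0) x))‖ := by
          congr 1; ring
      _ ≤ δ / 2 + δ / 2 := norm_add_le_of_le (hG₁ x) h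
      _ = δ := add_halves δ

/-- Below every positive continuous function there is a positive `C¹` function whose derivative
obeys the same bound. -/
lemma exists_contDiff_pos_le {ε : ℝ → ℝ} (hε : Continuous ε) (hpos : ∀ t, 0 < ε t) :
    ∃ v : ℝ → ℝ, ContDiff ℝ 1 v ∧ ∀ t, 0 < v t ∧ v t ≤ ε t ∧ |deriv v t| ≤ ε t := by
  let m (s : ℝ) : ℝ := sInf ((fun r ↦ ε (s - r)) '' Set.Icc 0 1)
  have hK : IsCompact (Set.Icc (0 : ℝ) 1) := isCompact_Icc
  have hm : Continuous m := hK.continuous_sInf (f := fun s r ↦ ε (s - r)) (by fun_prop)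
  have hmpos (s : ℝ) : 0 < m s := by
    obtain ⟨r, -, hr⟩ := hK.exists_sInf_image_eq (Set.nonempty_Icc.2 zero_le_one)
      (f := fun r ↦ ε (s - r)) (by fun_prop)
    exact (hpos _).trans_eq hr.symm
  have hmle {s t : ℝ} (h : s ∈ Set.Icc t (t + 1)) : m s ≤ ε t := by
    refine csInf_le (hK.bddBelow_image (by fun_prop)) ⟨s - t, ⟨?_, ?_⟩, ?_⟩
    · linarith [h.1]
    · linarith [h.2]
    · simp
  have hint (a b : ℝ) : IntervalIntegrable m volume a b := hm.intervalIntegrable a b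
  have hderiv (t : ℝ) : HasDerivAt (fun t ↦ ∫ s in t..t + 1, m s) (m (t + 1) - m t) t := by
    have h (c : ℝ) : HasDerivAt (fun t ↦ ∫ s in (0 : ℝ)..t, m s) (m c) c :=
      (hm.integral_hasStrictDerivAt 0 c).hasDerivAt
    refine (((h (t + 1)).comp_add_const t 1).sub (h t)).congr_of_eventuallyEq
      (Eventually.of_forall fun t ↦ ?_)
    exact (intervalIntegral.integral_interval_sub_left (hint _ _) (hint _ _)).symm
  refine ⟨fun t ↦ ∫ s in t..t + 1, m s, contDiff_one_iff_deriv.2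
    ⟨fun t ↦ (hderiv t).differentiableAt, ?_⟩, fun t ↦ ⟨?_, ?_, ?_⟩⟩
  · rw [funext fun t ↦ (hderiv t).deriv]
    fun_prop
  · exact intervalIntegral.intervalIntegral_pos_of_pos (hint _ _) hmpos (by linarith)
  · have := intervalIntegral.integral_mono_on (by linarith : t ≤ t + 1) (hint _ _)
      (intervalIntegrable_const (c := ε t)) fun s hs ↦ hmle hs
    simpa using this
  · rw [(hderiv t).deriv, abs_le]
    have h₁ := hmle (s := t + 1) (t := t) ⟨by linarith, le_rfl⟩
    have h₂ := hmle (s := t) (t := t) ⟨le_rfl, by linarith⟩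
    constructor <;> linarith [hmpos t, hmpos (t + 1)]

/-- Hoischen's approximation theorem: every `C¹` curve `σ : ℝ → ℂ` can be approximated,
together with its derivative, on the whole real line by an entire function, with error
controlled by an arbitrary positive continuous function `ε`. -/
theorem hoischen_approximation
    (σ : ℝ → ℂ) (hσ : ContDiff ℝ 1 σ)
    (ε : ℝ → ℝ) (hε : Continuous ε) (hεpos : ∀ t : ℝ, 0 < ε t) :
    ∃ f : ℂ → ℂ, Differentiable ℂ f ∧
      (∀ t : ℝ, ‖f t - σ t‖ < ε t) ∧
      (∀ t : ℝ, ‖deriv f t - deriv σ t‖ < ε t) := by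
  obtain ⟨v, hv, hvε⟩ := exists_contDiff_pos_le hε hεpos
  have hvd (t : ℝ) : HasDerivAt v (deriv v t) t := (hv.differentiable one_ne_zero t).hasDerivAt
  have hlog (t : ℝ) := (hvd t).log (hvε t).1.ne'
  obtain ⟨L, hL, hL₀, hL₁⟩ := exists_entire_approx_uniform
    (u := fun t ↦ (Real.log (v t) : ℂ))
    (Complex.ofRealCLM.contDiff.comp (hv.log fun t ↦ (hvε t).1.ne')) one_pos
  let H (z : ℂ) : ℂ := Complex.exp (L z)
  have hH (z : ℂ) : HasDerivAt H (H z * deriv L z) z := (hL z).hasDerivAt.cexp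
  have hHn (t : ℝ) : ‖H t‖ ≤ 3 * v t := by
    have h : (L t).re ≤ Real.log (v t) + 1 := by
      have := (Complex.re_le_norm _).trans (hL₀ t)
      rw [Complex.sub_re, Complex.ofReal_re] at this
      linarith
    calc ‖H t‖ = Real.exp (L t).re := Complex.norm_exp _
      _ ≤ Real.exp (Real.log (v t) + 1) := Real.exp_le_exp.2 h
      _ = v t * Real.exp 1 := by rw [Real.exp_add, Real.exp_log (hvε t).1]
      _ ≤ 3 * v t := by nlinarith [Real.exp_one_lt_three, (hvε t).1]
  have hLn (t : ℝ) : ‖deriv L t‖ ≤ ε t / v t + 1 := by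
    have h := norm_le_norm_add_norm_sub' (deriv L t) (deriv (fun t ↦ (Real.log (v t) : ℂ)) t)
    rw [(hlog t).ofReal_comp.deriv, Complex.norm_real, Real.norm_eq_abs, abs_div,
      abs_of_pos (hvε t).1] at h
    have h₁ := hL₁ t
    rw [(hlog t).ofReal_comp.deriv] at h₁
    have : |deriv v t| / v t ≤ ε t / v t := by
      have := (hvε t).1
      gcongr
      exact (hvε t).2.2
    linarith
  have hLr (t : ℝ) : HasDerivAt (fun t : ℝ ↦ H t) (H t * deriv L t) t := (hH t).comp_ofReal
  let τ (t : ℝ) : ℂ := Complex.exp (-L t) * σ t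
  have hτ : ContDiff ℝ 1 τ := by
    have hLc : ContDiff ℝ 1 L := (hL.contDiff (n := 1)).restrict_scalars ℝ
    exact ((hLc.comp Complex.ofRealCLM.contDiff).neg.cexp).mul hσ
  have hστ (t : ℝ) : σ t = H t * τ t := by
    simp only [H, τ]
    rw [← mul_assoc, ← Complex.exp_add, add_neg_cancel, Complex.exp_zero, one_mul]
  have hσ' (t : ℝ) : deriv σ t = H t * deriv L t * τ t + H t * deriv τ t := by
    rw [funext hστ]
    exact ((hLr t).mul (hτ.differentiable one_ne_zero t).hasDerivAt).deriv
  obtain ⟨F, hF, hF₀, hF₁⟩ := exists_entire_approx_uniform hτ (δ := 1 / 10) (by norm_num)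
  refine ⟨fun z ↦ H z * F z, fun z ↦ (hH z).differentiableAt.mul (hF z), fun t ↦ ?_, fun t ↦ ?_⟩
  · rw [hστ, ← mul_sub, norm_mul]
    calc ‖H t‖ * ‖F t - τ t‖ ≤ 3 * v t * (1 / 10) := by
          gcongr
          exacts [(norm_nonneg _).trans (hHn t), hHn t, hF₀ t]
      _ < ε t := by linarith [(hvε t).1, (hvε t).2.1]
  · have hd : deriv (fun z ↦ H z * F z) t = H t * deriv L t * F t + H t * deriv F t :=
      ((hH t).mul (hF t).hasDerivAt).deriv
    have hvt := (hvε t).1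
    rw [hσ', hd]
    calc ‖H t * deriv L t * F t + H t * deriv F t - (H t * deriv L t * τ t + H t * deriv τ t)‖
        = ‖H t‖ * ‖deriv L t * (F t - τ t) + (deriv F t - deriv τ t)‖ := by
          rw [← norm_mul]
          congr 1
          ring
      _ ≤ 3 * v t * ((ε t / v t + 1) * (1 / 10) + 1 / 10) := by
          gcongr
          · exact hHn t
          · refine norm_add_le_of_le ?_ (hF₁ t)
            rw [norm_mul]
            exact mul_le_mul (hLn t) (hF₀ t) (norm_nonneg _) ((norm_nonneg _).trans (hLn t))
      _ = 3 / 10 * (ε t + 2 * v t) := by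
          field_simp
          ring
      _ < ε t := by linarith [(hvε t).2.1, hεpos t]
end
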